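/- arXiv:2501.11125 — 4 statements merged into one kernel-verified Lean document; each statement's English description precedes it below -/
import Mathlib

section
/- Let p be a prime, K an algebraically closed field of characteristic p, G = Z/pZ, and V_1 the indecomposable representation of G over K of dimension 2. Then d(G, V_1) < 2. -/
open CategoryTheory MonoidalCategory Limits

noncomputable section

universe u

/-- The `n`-th tensor power of a representation, in the category `Rep k G`. -/
def tpow {k G : Type u} [Field k] [Monoid G] (V : Rep k G) : ℕ → Rep k G
  | 0 => 𝟙_ (Rep k G)
  | n + 1 => tpow V n ⊗ V

/-- `TS V` : the number of trivial direct summands of `V`, counted with multiplicity, i.e.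
the largest `n` such that the trivial representation on `k^n` is a direct summand of `V`. -/
def TS {k G : Type u} [Field k] [Monoid G] (V : Rep k G) : ℕ :=
  sSup {n : ℕ | ∃ W : Rep k G, Nonempty (V ≅ Rep.trivial k G (Fin n → k) ⊞ W)}

/-- `dG V = limsup_{n → ∞} TS(V^{⊗n})^(1/n)`. -/
def dG {k G : Type u} [Field k] [Monoid G] (V : Rep k G) : ℝ :=
  Filter.limsup (fun n : ℕ => (TS (tpow V n) : ℝ) ^ ((n : ℝ)⁻¹)) Filter.atTop

/-- A submodule is a subrepresentation if it is stable under the group action. -/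
def IsSubrep {k G V : Type u} [Field k] [Monoid G] [AddCommGroup V] [Module k V]
    (ρ : Representation k G V) (U : Submodule k V) : Prop :=
  ∀ g : G, ∀ v ∈ U, ρ g v ∈ U

/-- A representation is irreducible if it is nonzero and its only subrepresentations
are `⊥` and `⊤`. -/
def IsIrreducibleRep {k G V : Type u} [Field k] [Monoid G] [AddCommGroup V] [Module k V]
    (ρ : Representation k G V) : Prop :=
  (∃ v : V, v ≠ 0) ∧ ∀ U : Submodule k V, IsSubrep ρ U → U = ⊥ ∨ U = ⊤

/-- A representation is indecomposable if it is nonzero and is not the direct sum of two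
nonzero subrepresentations. -/
def IsIndecomposableRep {k G V : Type u} [Field k] [Monoid G] [AddCommGroup V] [Module k V]
    (ρ : Representation k G V) : Prop :=
  (∃ v : V, v ≠ 0) ∧
    ∀ U U' : Submodule k V, IsSubrep ρ U → IsSubrep ρ U' → IsCompl U U' → U = ⊥ ∨ U' = ⊥

/-- An object of `Rep k G` is indecomposable. -/
def RepIndecomposable {k G : Type u} [Field k] [Monoid G] (W : Rep k G) : Prop :=
  IsIndecomposableRep W.ρ

/-- The vectors fixed by `ρ` and killed by some linear map to `k ^ d` are norms modulo `U`. For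
`U = ⊥` this says that the Tate cohomology group `Ĥ⁰` of `ρ` has dimension at most `d`. -/
def TateBound {k G M : Type*} [Field k] [Group G] [Fintype G] [AddCommGroup M] [Module k M]
    (ρ : Representation k G M) (U : Submodule k M) (d : ℕ) : Prop :=
  ∃ φ : M →ₗ[k] (Fin d → k), ∀ v, (∀ g, ρ g v = v) → φ v = 0 → ∃ w, v - ρ.norm w ∈ U

theorem LinearMap.exists_generalized_inverse {k M N : Type*} [Field k] [AddCommGroup M]
    [Module k M] [AddCommGroup N] [Module k N] (L : M →ₗ[k] N) :
    ∃ P : N →ₗ[k] M, ∀ v, L (P (L v)) = L v := by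
  obtain ⟨r, hr⟩ := L.rangeRestrict.exists_rightInverse_of_surjective L.range_rangeRestrict
  obtain ⟨P, hP⟩ := r.exists_extend
  refine ⟨P, fun v => ?_⟩
  have h1 := LinearMap.congr_fun hP ⟨L v, v, rfl⟩
  have h2 := LinearMap.congr_fun hr ⟨L v, v, rfl⟩
  simp only [LinearMap.comp_apply, Submodule.subtype_apply] at h1
  rw [h1]
  exact congrArg Subtype.val h2

section Tensor

variable {k G A V : Type*} [Field k] [Group G] [AddCommGroup A] [Module k A]
  [AddCommGroup V] [Module k V]

open TensorProduct in
/-- The coefficient of `b i` in an element of `A ⊗ V`, for a basis `b` of `V`. -/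
def tensorCoord (A : Type*) [AddCommGroup A] [Module k A] (b : Module.Basis (Fin 2) k V)
    (i : Fin 2) : A ⊗[k] V →ₗ[k] A :=
  (TensorProduct.rid k A).toLinearMap ∘ₗ (b.coord i).lTensor A

open TensorProduct in
@[simp] theorem tensorCoord_tmul (b : Module.Basis (Fin 2) k V) (i : Fin 2) (a : A) (v : V) :
    tensorCoord A b i (a ⊗ₜ v) = b.repr v i • a := by
  simp [tensorCoord]

open TensorProduct in
theorem tensorCoord_decomp (b : Module.Basis (Fin 2) k V) (v : A ⊗[k] V) :
    v = tensorCoord A b 0 v ⊗ₜ b 0 + tensorCoord A b 1 v ⊗ₜ b 1 := by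
  induction v with
  | zero => simp
  | add u v hu hv =>
    nth_rewrite 1 [hu, hv]
    simp only [map_add, add_tmul]
    abel
  | tmul a v =>
    simp only [tensorCoord_tmul, smul_tmul, ← tmul_add]
    congr 1
    have := b.sum_repr v
    rw [Fin.sum_univ_two] at this
    exact this.symm

variable {ρ : Representation k G A} {σ : Representation k G V} {b : Module.Basis (Fin 2) k V}
  {χ : G → k}

theorem tensorCoord_zero_tprod (h0 : ∀ g, σ g (b 0) = b 0 + χ g • b 1)
    (h1 : ∀ g, σ g (b 1) = b 1) (g : G) (v : TensorProduct k A V) :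
    tensorCoord A b 0 (ρ.tprod σ g v) = ρ g (tensorCoord A b 0 v) := by
  conv_lhs => rw [tensorCoord_decomp b v]
  simp [h0, h1]

theorem tensorCoord_one_tprod (h1 : ∀ g, σ g (b 1) = b 1) (g : G) (v : TensorProduct k A V)
    (hv : tensorCoord A b 0 v = 0) :
    tensorCoord A b 1 (ρ.tprod σ g v) = ρ g (tensorCoord A b 1 v) := by
  conv_lhs => rw [tensorCoord_decomp b v, hv]
  simp [h1]

variable [Fintype G]

theorem Representation.map_norm_self (τ : Representation k G A) (g : G) (v : A) :
    τ g (τ.norm v) = τ.norm v :=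
  LinearMap.congr_fun (τ.self_comp_norm g) v

theorem norm_tprod_tmul_fixed (a : A) (y : V) (hy : ∀ g, σ g y = y) :
    (ρ.tprod σ).norm (a ⊗ₜ y) = ρ.norm a ⊗ₜ[k] y := by
  simp [Representation.norm, hy, TensorProduct.sum_tmul]

theorem TateBound.tprod (h0 : ∀ g, σ g (b 0) = b 0 + χ g • b 1) (h1 : ∀ g, σ g (b 1) = b 1)
    {U : Submodule k A} {d e : ℕ} (hd : TateBound ρ ⊥ d) (he : TateBound ρ U e) :
    TateBound (ρ.tprod σ) (U.map ((TensorProduct.mk k A V).flip (b 1))) (d + e) := by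
  obtain ⟨φ, hφ⟩ := hd
  obtain ⟨ψ, hψ⟩ := he
  obtain ⟨P, hP⟩ := LinearMap.exists_generalized_inverse ρ.norm
  let R : TensorProduct k A V →ₗ[k] TensorProduct k A V :=
    LinearMap.id - (ρ.tprod σ).norm ∘ₗ ((TensorProduct.mk k A V).flip (b 0)) ∘ₗ P ∘ₗ
      tensorCoord A b 0
  let E : ((Fin d → k) × (Fin e → k)) ≃ₗ[k] (Fin (d + e) → k) :=
    (LinearEquiv.sumArrowLequivProdArrow (Fin d) (Fin e) k k).symm ≪≫ₗ
      LinearEquiv.funCongrLeft k k finSumFinEquiv.symm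
  refine ⟨E.toLinearMap ∘ₗ LinearMap.prod (φ ∘ₗ tensorCoord A b 0)
    (ψ ∘ₗ tensorCoord A b 1 ∘ₗ R), fun v hv hz => ?_⟩
  have hz' := (E.map_eq_zero_iff).1 hz
  have hz1 : φ (tensorCoord A b 0 v) = 0 := congrArg Prod.fst hz'
  have hz2 : ψ (tensorCoord A b 1 (R v)) = 0 := congrArg Prod.snd hz'
  obtain ⟨w, hw⟩ := hφ _ (fun g => by rw [← tensorCoord_zero_tprod h0 h1, hv]) hz1
  have hw' : tensorCoord A b 0 v = ρ.norm w := by simpa [sub_eq_zero] using hw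
  have hR : R v = v - (ρ.tprod σ).norm (P (tensorCoord A b 0 v) ⊗ₜ b 0) := rfl
  have hRfix : ∀ g, ρ.tprod σ g (R v) = R v := fun g => by
    rw [hR, map_sub, hv, Representation.map_norm_self]
  have hR0 : tensorCoord A b 0 (R v) = 0 := by
    have : tensorCoord A b 0 ((ρ.tprod σ).norm (P (tensorCoord A b 0 v) ⊗ₜ b 0))
        = ρ.norm (P (tensorCoord A b 0 v)) := by
      simp only [Representation.norm, LinearMap.sum_apply, map_sum, tensorCoord_zero_tprod h0 h1]
      simp
    rw [hR, map_sub, this, hw', hP, sub_self]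
  obtain ⟨w', hw''⟩ := hψ _ (fun g => by rw [← tensorCoord_one_tprod h1 g _ hR0, hRfix]) hz2
  refine ⟨P (tensorCoord A b 0 v) ⊗ₜ b 0 + w' ⊗ₜ b 1, _, hw'', ?_⟩
  have hRv := tensorCoord_decomp b (R v)
  rw [hR0, TensorProduct.zero_tmul, zero_add] at hRv
  rw [map_add, norm_tprod_tmul_fixed w' _ h1, ← sub_sub, ← hR]
  simp only [LinearMap.flip_apply, TensorProduct.mk_apply, TensorProduct.sub_tmul]
  rw [← hRv]

end Tensor

/-- Tensoring with `z ⊗ ⋯ ⊗ z` on the right. -/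
def tensorTail {k G : Type u} [Field k] [Monoid G] (V : Rep k G) (z : V) (n : ℕ) :
    (m : ℕ) → tpow V n →ₗ[k] tpow V (n + m)
  | 0 => LinearMap.id
  | m + 1 => ((TensorProduct.mk k (tpow V (n + m)) V).flip z) ∘ₗ tensorTail V z n m

section Power

variable {k G : Type u} [Field k] [Group G] {V : Rep k G}

theorem tpow_ρ_tensorTail (z : V) (n m : ℕ) (g : G) (v : tpow V n) :
    (tpow V (n + m)).ρ g (tensorTail V z n m v) =
      tensorTail V (V.ρ g z) n m ((tpow V n).ρ g v) := by
  induction m with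
  | zero => rfl
  | succ m ih =>
    exact congrArg (fun u => TensorProduct.tmul k u (V.ρ g z)) ih

theorem tensorTail_injective (b : Module.Basis (Fin 2) k V) (n m : ℕ) :
    Function.Injective (tensorTail V (b 1) n m) := by
  induction m with
  | zero => exact fun _ _ h => h
  | succ m ih =>
    intro u v h
    apply ih
    have h' : TensorProduct.tmul k (tensorTail V (b 1) n m u) (b 1)
      = TensorProduct.tmul k (tensorTail V (b 1) n m v) (b 1) := h
    simpa using congrArg (tensorCoord _ b 1) h'

variable [Fintype G] {b : Module.Basis (Fin 2) k V} {χ : G → k}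

theorem tateBound_tpow_add (h0 : ∀ g, V.ρ g (b 0) = b 0 + χ g • b 1)
    (h1 : ∀ g, V.ρ g (b 1) = b 1) {n d : ℕ} (hd : TateBound (tpow V n).ρ ⊥ d) (m : ℕ) :
    TateBound (tpow V (n + m)).ρ ⊥ (2 ^ m * d) := by
  induction m with
  | zero => simpa using hd
  | succ m ih =>
    have := TateBound.tprod h0 h1 ih ih
    rw [Submodule.map_bot] at this
    rw [pow_succ, mul_two, add_mul]
    exact this

theorem tateBound_tpow_add_range (h0 : ∀ g, V.ρ g (b 0) = b 0 + χ g • b 1)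
    (h1 : ∀ g, V.ρ g (b 1) = b 1) {n d : ℕ} (hd : TateBound (tpow V n).ρ ⊥ d) (m : ℕ) :
    TateBound (tpow V (n + m)).ρ (tensorTail V (b 1) n m).range ((2 ^ m - 1) * d) := by
  induction m with
  | zero => exact ⟨0, fun v _ _ => ⟨0, ⟨_, rfl⟩⟩⟩
  | succ m ih =>
    have := TateBound.tprod h0 h1 (tateBound_tpow_add h0 h1 hd m) ih
    rw [← LinearMap.range_comp, ← add_mul] at this
    have h2 : 2 ^ m + (2 ^ m - 1) = 2 ^ (m + 1) - 1 := by
      have := Nat.one_le_two_pow (n := m)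
      rw [pow_succ]
      omega
    rw [h2] at this
    exact this

end Power

section Cyclic

variable {k : Type} [Field k] {p : ℕ} [Fact p.Prime] [CharP k p]
  {V : Rep k (Multiplicative (ZMod p))} {b : Module.Basis (Fin 2) k V}

theorem sum_pow_smul_tensorTail (n m j : ℕ) (hjm : j + m ≤ p - 1) (v : tpow V n) :
    ∑ i : ZMod p, ((i.cast : k) ^ j) • tensorTail V (b 0 + (i.cast : k) • b 1) n m v =
      if j + m = p - 1 then -tensorTail V (b 1) n m v else 0 := by
  induction m generalizing j with
  | zero =>
    change ∑ i : ZMod p, ((i.cast : k) ^ j) • v = if j + 0 = p - 1 then -v else 0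
    have hs : ∑ i : ZMod p, (i.cast : k) ^ j = ((∑ i : ZMod p, i ^ j : ZMod p).cast : k) := by
      change _ = ZMod.castHom dvd_rfl k _
      simp
    rw [← Finset.sum_smul, hs]
    split_ifs with h
    · have hp := (Fact.out : p.Prime).two_le
      have : ∑ i : ZMod p, i ^ j = -1 := by
        have hj : j ≠ 0 := by omega
        have : ∀ i : ZMod p, i ^ j = 1 - if i = 0 then 1 else 0 := fun i => by
          split_ifs with hi
          · simp [hi, hj]
          · rw [add_zero] at h
            rw [h, ZMod.pow_card_sub_one_eq_one hi, sub_zero]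
        simp [this]
      rw [this]
      change ZMod.castHom dvd_rfl k _ • v = _
      simp
    · rw [FiniteField.sum_pow_lt_card_sub_one]
      · simp
      · rw [ZMod.card]; omega
  | succ m ih =>
    have hstep : ∀ i : ZMod p,
        ((i.cast : k) ^ j) • tensorTail V (b 0 + (i.cast : k) • b 1) n (m + 1) v =
        TensorProduct.tmul k
          (((i.cast : k) ^ j) • tensorTail V (b 0 + (i.cast : k) • b 1) n m v) (b 0) +
        TensorProduct.tmul k
          (((i.cast : k) ^ (j + 1)) • tensorTail V (b 0 + (i.cast : k) • b 1) n m v) (b 1) := by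
      intro i
      change ((i.cast : k) ^ j) • TensorProduct.tmul k _ _ = _
      rw [TensorProduct.tmul_add, smul_add, TensorProduct.tmul_smul, smul_smul, ← pow_succ]
      rfl
    simp only [hstep]
    refine Finset.sum_add_distrib.trans ?_
    refine (congrArg₂ (fun u v : TensorProduct k (tpow V (n + m)) V => u + v)
      (TensorProduct.sum_tmul _ _ _).symm (TensorProduct.sum_tmul _ _ _).symm).trans ?_
    rw [ih j (by omega), ih (j + 1) (by omega), if_neg (by omega), TensorProduct.zero_tmul,
      zero_add, add_right_comm, add_assoc]
    split_ifs
    · exact TensorProduct.neg_tmul _ _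
    · exact TensorProduct.zero_tmul _ _

theorem tateBound_tpow_add_sub_one
    (h0 : ∀ g, V.ρ g (b 0) = b 0 + ((Multiplicative.toAdd g).cast : k) • b 1)
    (h1 : ∀ g, V.ρ g (b 1) = b 1) {n d : ℕ} (hd : TateBound (tpow V n).ρ ⊥ d) :
    TateBound (tpow V (n + (p - 1))).ρ ⊥ ((2 ^ (p - 1) - 1) * d) := by
  obtain ⟨φ, hφ⟩ := tateBound_tpow_add_range h0 h1 hd (p - 1)
  refine ⟨φ, fun v hv hz => ?_⟩
  obtain ⟨w, a, ha⟩ := hφ v hv hz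
  have hfix : ∀ g, (tpow V n).ρ g a = a := fun g => by
    apply tensorTail_injective b n (p - 1)
    have := tpow_ρ_tensorTail (b 1) n (p - 1) g a
    rw [h1] at this
    rw [← this, ha, map_sub, hv, Representation.map_norm_self]
  have hnorm : (tpow V (n + (p - 1))).ρ.norm (tensorTail V (b 0) n (p - 1) a) =
      -tensorTail V (b 1) n (p - 1) a := by
    have := sum_pow_smul_tensorTail (b := b) n (p - 1) 0 (by omega) a
    simp only [pow_zero, one_smul, zero_add, if_true] at this
    rw [← this, Representation.norm, LinearMap.sum_apply]
    refine Fintype.sum_equiv Multiplicative.toAdd _ _ fun g => ?_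
    rw [tpow_ρ_tensorTail, hfix, h0]
  refine ⟨w - tensorTail V (b 0) n (p - 1) a, ?_⟩
  rw [map_sub, hnorm, ha, Submodule.mem_bot]
  abel

theorem tateBound_tpow
    (h0 : ∀ g, V.ρ g (b 0) = b 0 + ((Multiplicative.toAdd g).cast : k) • b 1)
    (h1 : ∀ g, V.ρ g (b 1) = b 1) (m r : ℕ) :
    TateBound (tpow V ((p - 1) * m + r)).ρ ⊥ (2 ^ r * (2 ^ (p - 1) - 1) ^ m) := by
  apply tateBound_tpow_add h0 h1
  induction m with
  | zero =>
    refine ⟨LinearMap.pi fun _ => LinearMap.id, fun v _ hv => ⟨0, ?_⟩⟩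
    have : v = 0 := congrFun hv 0
    simp [this]
  | succ m ih =>
    rw [mul_add, mul_one, pow_succ']
    exact tateBound_tpow_add_sub_one h0 h1 ih

theorem TS_le_of_tateBound {W : Rep k (Multiplicative (ZMod p))} {d : ℕ}
    (h : TateBound W.ρ ⊥ d) : TS W ≤ d := by
  obtain ⟨φ, hφ⟩ := h
  refine csSup_le' ?_
  rintro n ⟨X, ⟨e⟩⟩
  let i := biprod.inl ≫ e.inv
  let q := e.hom ≫ biprod.fst
  have hiq : ∀ v, q.hom (i.hom v) = v := fun v => by
    have : i ≫ q = 𝟙 _ := by simp [i, q]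
    exact congrArg (fun f => f.hom v) this
  have hinj : Function.Injective (φ ∘ₗ i.hom.toLinearMap) := by
    rw [injective_iff_map_eq_zero]
    intro v hv
    obtain ⟨w, hw⟩ := hφ (i.hom v) (fun g => (Rep.hom_comm_apply i g v).symm) hv
    have hw' : i.hom v = W.ρ.norm w := by simpa [sub_eq_zero] using hw
    rw [← hiq v, hw', Representation.norm, LinearMap.sum_apply, map_sum]
    have : ∀ g, q.hom (W.ρ g w) = q.hom w := fun g => Rep.hom_comm_apply q g w
    rw [Finset.sum_congr rfl fun g _ => this g, Finset.sum_const, ← Nat.cast_smul_eq_nsmul k]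
    simp
  simpa using LinearMap.finrank_le_finrank_of_injective hinj

theorem exists_unipotent_basis {V : Type} [AddCommGroup V] [Module k V]
    [FiniteDimensional k V] (ρ : Representation k (Multiplicative (ZMod p)) V)
    (hdim : Module.finrank k V = 2) (hind : IsIndecomposableRep ρ) :
    ∃ b : Module.Basis (Fin 2) k V,
      (∀ g, ρ g (b 0) = b 0 + ((Multiplicative.toAdd g).cast : k) • b 1) ∧
        ∀ g, ρ g (b 1) = b 1 := by
  have hp := (Fact.out : p.Prime)
  set g₀ : Multiplicative (ZMod p) := Multiplicative.ofAdd 1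
  have hgen : ∀ g : Multiplicative (ZMod p), g = g₀ ^ (Multiplicative.toAdd g).val := fun g => by
    apply Multiplicative.toAdd.injective
    simp [g₀]
  set T : Module.End k V := ρ g₀ - 1
  have hnil : IsNilpotent T := by
    have : Nontrivial V := Module.nontrivial_of_finrank_pos (R := k) (by omega)
    have : CharP (Module.End k V) p := charP_of_injective_algebraMap
      (FaithfulSMul.algebraMap_injective k (Module.End k V)) p
    refine ⟨p, ?_⟩
    rw [sub_pow_char_of_commute _ (Commute.one_right _), ← map_pow]
    have : g₀ ^ p = 1 := by
      apply Multiplicative.toAdd.injective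
      simp [g₀]
    simp [this]
  have hT2 : ∀ v, T (T v) = 0 := by
    obtain ⟨m, hm⟩ := hnil
    intro v
    have := Module.End.ker_pow_le_ker_pow_finrank T m (show v ∈ _ by simp [hm])
    rw [hdim] at this
    simpa [pow_two] using this
  have hTne : ∃ x, T x ≠ 0 := by
    by_contra! hT
    have h1 : ∀ v, ρ g₀ v = v := fun v => sub_eq_zero.1 (hT v)
    have hfix : ∀ g v, ρ g v = v := fun g v => by
      have : ρ g₀ = 1 := LinearMap.ext h1
      rw [hgen g, map_pow, this, one_pow]
      rfl
    obtain ⟨⟨v, hv⟩, h⟩ := hind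
    obtain ⟨U', hU'⟩ := (k ∙ v).exists_isCompl
    have hs := Submodule.finrank_add_eq_of_isCompl hU'
    rw [finrank_span_singleton hv, hdim] at hs
    rcases h (k ∙ v) U' (fun g v hv => by rwa [hfix]) (fun g v hv => by rwa [hfix]) hU' with h | h
    · exact hv (Submodule.span_singleton_eq_bot.1 h)
    · rw [h, finrank_bot] at hs
      omega
  obtain ⟨x, hx⟩ := hTne
  have hli : LinearIndependent k ![x, T x] := by
    rw [LinearIndependent.pair_iff]
    intro s t h
    have h' : s • T x = 0 := by simpa [hT2] using congrArg T h
    have hs : s = 0 := (smul_eq_zero.1 h').resolve_right hx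
    refine ⟨hs, ?_⟩
    rw [hs, zero_smul, zero_add] at h
    exact (smul_eq_zero.1 h).resolve_right hx
  let b := basisOfLinearIndependentOfCardEqFinrank hli (by simp [hdim])
  have hb0 : b 0 = x := by simp [b]
  have hb1 : b 1 = T x := by simp [b]
  have hgx : ρ g₀ x = x + T x := by simp [T]
  have hgy : ρ g₀ (T x) = T x := sub_eq_zero.1 (hT2 x)
  have hpowy : ∀ n : ℕ, (ρ g₀ ^ n) (T x) = T x := fun n => by
    induction n with
    | zero => rfl
    | succ n ih => rw [pow_succ, Module.End.mul_apply, hgy, ih]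
  have hpowx : ∀ n : ℕ, (ρ g₀ ^ n) x = x + (n : k) • T x := fun n => by
    induction n with
    | zero => simp
    | succ n ih =>
      rw [pow_succ, Module.End.mul_apply, hgx, map_add, ih, hpowy]
      push_cast
      rw [add_smul, one_smul, add_assoc]
  refine ⟨b, fun g => ?_, fun g => ?_⟩
  · rw [hb0, hb1, hgen g, map_pow, hpowx, ← hgen g, ZMod.natCast_val]
  · rw [hb1, hgen g, map_pow, hpowy]

end Cyclic

theorem limsup_rpow_inv_lt_two {f : ℕ → ℕ} {q : ℕ} (hq : 0 < q)
    (hf : ∀ m r, f (q * m + r) ≤ 2 ^ r * (2 ^ q - 1) ^ m) :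
    Filter.limsup (fun n : ℕ => (f n : ℝ) ^ ((n : ℝ)⁻¹)) Filter.atTop < 2 := by
  set a : ℝ := 2 ^ q - 1
  have ha1 : 1 ≤ a := by
    have : (2 : ℝ) ^ 1 ≤ 2 ^ q := pow_le_pow_right₀ (by norm_num) hq
    simp only [a]
    linarith
  set c : ℝ := a ^ ((q : ℝ)⁻¹)
  have hc1 : 1 ≤ c := Real.one_le_rpow ha1 (by positivity)
  have hcq : c ^ q = a := Real.rpow_inv_natCast_pow (by linarith) hq.ne'
  have hc2 : c < 2 := lt_of_pow_lt_pow_left₀ q (by norm_num) (by rw [hcq]; simp [a])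
  have hbound : ∀ n, (f n : ℝ) ≤ 2 ^ q * c ^ n := fun n => by
    have h := hf (n / q) (n % q)
    rw [Nat.div_add_mod] at h
    have h' : (f n : ℝ) ≤ 2 ^ (n % q) * a ^ (n / q) := by
      have := (Nat.cast_le (α := ℝ)).2 h
      rwa [Nat.cast_mul, Nat.cast_pow, Nat.cast_pow, Nat.cast_sub Nat.one_le_two_pow,
        Nat.cast_pow, Nat.cast_one, Nat.cast_ofNat] at this
    refine h'.trans (mul_le_mul ?_ ?_ (by positivity) (by positivity))
    · exact pow_le_pow_right₀ (by norm_num) (Nat.mod_lt n hq).le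
    · rw [← hcq, ← pow_mul]
      exact pow_le_pow_right₀ hc1 (Nat.mul_div_le n q)
  have hlim : Filter.Tendsto (fun n : ℕ => ((2 : ℝ) ^ q) ^ ((n : ℝ)⁻¹) * c) Filter.atTop
      (nhds c) := by
    have h1 : Filter.Tendsto (fun n : ℕ => ((2 : ℝ) ^ q) ^ ((n : ℝ)⁻¹)) Filter.atTop
        (nhds (((2 : ℝ) ^ q) ^ (0 : ℝ))) :=
      tendsto_const_nhds.rpow (tendsto_inv_atTop_nhds_zero_nat (𝕜 := ℝ)) (Or.inl (by positivity))
    simpa using h1.mul_const c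
  have hle : (fun n : ℕ => (f n : ℝ) ^ ((n : ℝ)⁻¹)) ≤ᶠ[Filter.atTop]
      fun n : ℕ => ((2 : ℝ) ^ q) ^ ((n : ℝ)⁻¹) * c := by
    filter_upwards [Filter.eventually_gt_atTop 0] with n hn
    calc (f n : ℝ) ^ ((n : ℝ)⁻¹) ≤ (2 ^ q * c ^ n) ^ ((n : ℝ)⁻¹) :=
          Real.rpow_le_rpow (Nat.cast_nonneg _) (hbound n) (by positivity)
      _ = _ := by
          rw [Real.mul_rpow (by positivity) (by positivity),
            Real.pow_rpow_inv_natCast (by positivity) hn.ne']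
  refine lt_of_le_of_lt ?_ hc2
  rw [← hlim.limsup_eq]
  exact Filter.limsup_le_limsup hle
    (Filter.isCoboundedUnder_le_of_le _ (x := 0) fun n => by positivity)
    hlim.isBoundedUnder_le

/-- **Proposition.** For `G = ℤ/pℤ` over an algebraically closed field of characteristic
`p`, and `V₁` the two-dimensional indecomposable representation, `d(G, V₁) < 2`. -/
theorem dG_lt_two_of_indecomposable_two_dim {k : Type} [Field k] [IsAlgClosed k]
    (p : ℕ) [Fact p.Prime] [CharP k p] {V : Type} [AddCommGroup V] [Module k V]
    [FiniteDimensional k V] (ρ : Representation k (Multiplicative (ZMod p)) V)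
    (hdim : Module.finrank k V = 2) (hind : IsIndecomposableRep ρ) :
    dG (Rep.of ρ) < 2 := by
  obtain ⟨b, h0, h1⟩ := exists_unipotent_basis ρ hdim hind
  have hp := (Fact.out : p.Prime).two_le
  exact limsup_rpow_inv_lt_two (q := p - 1) (by omega) fun m r =>
    TS_le_of_tateBound (tateBound_tpow (V := Rep.of ρ) h0 h1 m r)
end
end

section
/- Let p be a prime, K an algebraically closed field of characteristic p, G = Z/pZ, and V a finite-dimensional representation of G over K having some indecomposable direct summand V_i with i ≠ 0 (equivalently, G does not act trivially on V). Then d(G, V) < dim V. -/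
open CategoryTheory MonoidalCategory Limits

noncomputable section

universe u

section RelativeTrace

variable {k G : Type u} [Field k] [Group G] [Fintype G]

/-- The relative trace `∑ g, g h g⁻¹` of a linear endomorphism `h` of a representation. -/
def relTrace (A : Rep.{u} k G) (h : A.V →ₗ[k] A.V) : A.V →ₗ[k] A.V :=
  ∑ g : G, A.ρ g ∘ₗ h ∘ₗ A.ρ g⁻¹

/-- Modulo relative traces, the identity of `A` factors through a `d`-dimensional vector space. -/
def FactorsModTrace (A : Rep.{u} k G) (d : ℕ) : Prop :=
  ∃ (h : A.V →ₗ[k] A.V) (α : A.V →ₗ[k] (Fin d → k)) (β : (Fin d → k) →ₗ[k] A.V),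
    ∀ x, x = relTrace A h x + β (α x)

lemma relTrace_apply (A : Rep.{u} k G) (h : A.V →ₗ[k] A.V) (x : A.V) :
    relTrace A h x = ∑ g : G, A.ρ g (h (A.ρ g⁻¹ x)) := by
  simp [relTrace]

lemma relTrace_comm (A : Rep.{u} k G) (h : A.V →ₗ[k] A.V) (g : G) (x : A.V) :
    relTrace A h (A.ρ g x) = A.ρ g (relTrace A h x) := by
  simp only [relTrace_apply, map_sum]
  refine Fintype.sum_equiv (Equiv.mulLeft g⁻¹) _ _ fun a => ?_
  rw [← Module.End.mul_apply (A.ρ a⁻¹), ← map_mul, Equiv.coe_mulLeft,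
    ← Module.End.mul_apply (A.ρ g), ← map_mul, mul_inv_rev, inv_inv, mul_inv_cancel_left]

lemma relTrace_conj {A B : Rep.{u} k G} (i : A ⟶ B) (q : B ⟶ A) (h : B.V →ₗ[k] B.V) (x : A.V) :
    relTrace A (q.hom.toLinearMap ∘ₗ h ∘ₗ i.hom.toLinearMap) x =
      q.hom (relTrace B h (i.hom x)) := by
  simp [relTrace_apply, Rep.hom_comm_apply]

lemma FactorsModTrace.of_retract {A B : Rep.{u} k G} {d : ℕ} (hB : FactorsModTrace B d)
    (i : A ⟶ B) (q : B ⟶ A) (hiq : i ≫ q = 𝟙 A) : FactorsModTrace A d := by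
  obtain ⟨h, α, β, hx⟩ := hB
  refine ⟨q.hom.toLinearMap ∘ₗ h ∘ₗ i.hom.toLinearMap, α ∘ₗ i.hom.toLinearMap,
    q.hom.toLinearMap ∘ₗ β, fun x => ?_⟩
  have h1 : q.hom (i.hom x) = x := by
    have := congrArg (fun f => f.hom x) hiq
    simpa using this
  rw [relTrace_conj]
  conv_lhs => rw [← h1, hx (i.hom x), map_add]
  rfl

lemma FactorsModTrace.of_iso {A B : Rep.{u} k G} {d : ℕ} (hB : FactorsModTrace B d)
    (e : A ≅ B) : FactorsModTrace A d :=
  hB.of_retract e.hom e.inv e.hom_inv_id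

lemma factorsModTrace_finrank (A : Rep.{u} k G) [FiniteDimensional k A.V] :
    FactorsModTrace A (Module.finrank k A.V) :=
  let e := (Module.finBasis k A.V).equivFun
  ⟨0, e.toLinearMap, e.symm.toLinearMap, fun x => by simp [relTrace_apply]⟩

lemma FactorsModTrace.tensor {A B : Rep.{u} k G} {a b : ℕ} (hA : FactorsModTrace A a)
    (hB : FactorsModTrace B b) : FactorsModTrace (A ⊗ B) (a * b) := by
  obtain ⟨h, α, β, hx⟩ := hA
  obtain ⟨h', α', β', hy⟩ := hB
  let e : TensorProduct k (Fin a → k) (Fin b → k) ≃ₗ[k] (Fin (a * b) → k) :=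
    LinearEquiv.ofFinrankEq _ _ (by simp)
  let H : TensorProduct k A.V B.V →ₗ[k] TensorProduct k A.V B.V :=
    TensorProduct.map h LinearMap.id + TensorProduct.map (β ∘ₗ α) h'
  refine ⟨H, e.toLinearMap ∘ₗ TensorProduct.map α α',
    TensorProduct.map β β' ∘ₗ e.symm.toLinearMap, fun z => ?_⟩
  have hβ (g : G) (x : A.V) : A.ρ g (β (α (A.ρ g⁻¹ x))) = β (α x) := by
    have h1 (x) : β (α x) = x - relTrace A h x := eq_sub_of_add_eq' (hx x).symm
    rw [h1, h1, relTrace_comm, ← map_sub, Representation.self_inv_apply]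
  have key (z : TensorProduct k A.V B.V) : z = (∑ g : G,
      TensorProduct.map (A.ρ g) (B.ρ g) (H (TensorProduct.map (A.ρ g⁻¹) (B.ρ g⁻¹) z))) +
      TensorProduct.map β β' (TensorProduct.map α α' z) := by
    induction z using TensorProduct.induction_on with
    | zero => simp
    | add x y hx hy =>
      conv_lhs => rw [hx, hy]
      simp only [map_add, Finset.sum_add_distrib]
      abel
    | tmul x y =>
      have h1 (g : G) : TensorProduct.map (A.ρ g) (B.ρ g)
          (H (TensorProduct.map (A.ρ g⁻¹) (B.ρ g⁻¹) (x ⊗ₜ y))) =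
          A.ρ g (h (A.ρ g⁻¹ x)) ⊗ₜ[k] y + β (α x) ⊗ₜ[k] B.ρ g (h' (B.ρ g⁻¹ y)) := by
        simp [H, hβ]
      simp_rw [h1]
      rw [Finset.sum_add_distrib, ← TensorProduct.sum_tmul, ← TensorProduct.tmul_sum,
        TensorProduct.map_tmul, TensorProduct.map_tmul, ← relTrace_apply, ← relTrace_apply,
        add_assoc, ← TensorProduct.tmul_add, ← hy, ← TensorProduct.add_tmul, ← hx]
  rw [relTrace_apply, LinearMap.comp_apply, LinearMap.comp_apply, LinearEquiv.coe_coe,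
    LinearEquiv.coe_coe, e.symm_apply_apply]
  exact key z

lemma FactorsModTrace.le_of_trivial (hG : (Fintype.card G : k) = 0) {n d : ℕ}
    (h : FactorsModTrace (Rep.trivial k G (Fin n → k)) d) : n ≤ d := by
  obtain ⟨h, α, β, hx⟩ := h
  have hinj : Function.Injective α := by
    refine Function.LeftInverse.injective (g := β) fun x => ?_
    have := hx x
    rw [relTrace_apply] at this
    have hz : ∑ g : G, (Rep.trivial k G (Fin n → k)).ρ g
        (h ((Rep.trivial k G (Fin n → k)).ρ g⁻¹ x)) = 0 := by
      change ∑ _ : G, h x = 0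
      rw [Finset.sum_const, Finset.card_univ, ← Nat.cast_smul_eq_nsmul k, hG, zero_smul]
    rw [hz, zero_add] at this
    exact this.symm
  simpa using LinearMap.finrank_le_finrank_of_injective hinj

lemma FactorsModTrace.TS_le (hG : (Fintype.card G : k) = 0) {A : Rep.{u} k G} {d : ℕ}
    (h : FactorsModTrace A d) : TS A ≤ d := by
  refine csSup_le' ?_
  rintro n ⟨W, ⟨e⟩⟩
  exact ((h.of_retract (biprod.inl ≫ e.inv) (e.hom ≫ biprod.fst) (by simp))).le_of_trivial hG

/-- If the norm element does not annihilate `A`, then `A` has a nonzero projective part. -/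
lemma exists_factorsModTrace_lt_finrank (A : Rep.{u} k G) [FiniteDimensional k A.V] (a : A.V)
    (ha : ∑ g : G, A.ρ g a ≠ 0) : ∃ r < Module.finrank k A.V, FactorsModTrace A r := by
  set b := ∑ g : G, A.ρ g a with hb
  obtain ⟨φ, hφ⟩ := Module.Projective.exists_dual_ne_zero k ha
  have hinv (g : G) : A.ρ g b = b := by
    rw [hb, map_sum]
    refine Fintype.sum_equiv (Equiv.mulLeft g) _ _ fun x => ?_
    simp
  let h : A.V →ₗ[k] A.V := (φ.smulRight ((φ b)⁻¹ • a))
  let f : A.V →ₗ[k] A.V := LinearMap.id - relTrace A h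
  have hfb : f b = 0 := by
    have : relTrace A h b = b := by
      simp only [relTrace_apply, hinv, h, LinearMap.smulRight_apply, smul_smul,
        mul_inv_cancel₀ hφ, one_smul]
      rfl
    simp [f, this]
  let e := (Module.finBasis k (LinearMap.range f)).equivFun
  refine ⟨Module.finrank k (LinearMap.range f), ?_, h, e.toLinearMap ∘ₗ f.rangeRestrict,
    (LinearMap.range f).subtype ∘ₗ e.symm.toLinearMap, fun x => by simp [f]⟩
  have hker : 0 < Module.finrank k (LinearMap.ker f) := by
    rw [Module.finrank_pos_iff_exists_ne_zero]
    exact ⟨⟨b, hfb⟩, fun hh => ha (congrArg Subtype.val hh)⟩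
  have := f.finrank_range_add_finrank_ker
  omega

end RelativeTrace

section TensorPower

variable {k G : Type u} [Field k]

instance finiteDimensional_tpow [Monoid G] (V : Rep.{u} k G) [FiniteDimensional k V.V] :
    ∀ n, FiniteDimensional k (tpow V n).V
  | 0 => inferInstanceAs (FiniteDimensional k k)
  | n + 1 =>
    haveI := finiteDimensional_tpow V n
    inferInstanceAs (FiniteDimensional k (TensorProduct k (tpow V n).V V.V))

lemma finrank_tpow [Monoid G] (V : Rep.{u} k G) (n : ℕ) :
    Module.finrank k (tpow V n).V = Module.finrank k V.V ^ n := by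
  induction n with
  | zero => exact Module.finrank_self k
  | succ n ih =>
    rw [pow_succ, ← ih]
    exact Module.finrank_tensorProduct (R := k) (S := k) (M := (tpow V n).V) (M' := V.V)

/-- Tensor powers of a representation are additive in the exponent. -/
def tpowAdd [Monoid G] (V : Rep.{u} k G) (m : ℕ) : ∀ n, tpow V (m + n) ≅ tpow V m ⊗ tpow V n
  | 0 => (ρ_ (tpow V m)).symm
  | n + 1 => whiskerRightIso (tpowAdd V m n) V ≪≫ α_ (tpow V m) (tpow V n) V

/-- The tensor power of a vector. -/
def vecPow [Monoid G] (V : Rep.{u} k G) (v : V.V) : ∀ n, (tpow V n).V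
  | 0 => (1 : k)
  | n + 1 => TensorProduct.tmul k (vecPow V v n) v

/-- The tensor power of a linear functional. -/
def dualPow [Monoid G] (V : Rep.{u} k G) (φ : V.V →ₗ[k] k) : ∀ n, (tpow V n).V →ₗ[k] k
  | 0 => (LinearMap.id : k →ₗ[k] k)
  | n + 1 => (LinearMap.mul' k k) ∘ₗ TensorProduct.map (dualPow V φ n) φ

lemma dualPow_vecPow [Monoid G] (V : Rep.{u} k G) (φ : V.V →ₗ[k] k) (v : V.V) (n : ℕ) :
    dualPow V φ n (vecPow V v n) = φ v ^ n := by
  induction n with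
  | zero => exact (pow_zero _).symm
  | succ n ih =>
    rw [pow_succ, ← ih]
    rfl

lemma tpow_ρ_vecPow [Monoid G] (V : Rep.{u} k G) (g : G) (v : V.V) (n : ℕ) :
    (tpow V n).ρ g (vecPow V v n) = vecPow V (V.ρ g v) n := by
  induction n with
  | zero => rfl
  | succ n ih =>
    change TensorProduct.tmul k ((tpow V n).ρ g (vecPow V v n)) (V.ρ g v) = _
    rw [ih]
    rfl

lemma FactorsModTrace.tpow_mul_add [Group G] [Fintype G] (V : Rep.{u} k G)
    [FiniteDimensional k V.V] {m a : ℕ} (h : FactorsModTrace (tpow V m) a) (q r : ℕ) :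
    FactorsModTrace (tpow V (m * q + r)) (a ^ q * Module.finrank k V.V ^ r) := by
  induction q with
  | zero =>
    have := factorsModTrace_finrank (tpow V r)
    rw [finrank_tpow] at this
    simpa using this
  | succ q ih =>
    rw [show m * (q + 1) + r = m + (m * q + r) by ring, pow_succ', mul_assoc]
    exact (h.tensor ih).of_iso (tpowAdd V m _)

end TensorPower

/-- A nontrivial endomorphism `T` with `T ^ p = 1` has a Jordan block of size at least two. -/
lemma exists_jordan_pair {k V : Type*} [Field k] (p : ℕ) [Fact p.Prime] [CharP k p]
    [AddCommGroup V] [Module k V] (T : Module.End k V) (hT : T ^ p = 1) (hne : T ≠ 1) :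
    ∃ v w : V, w ≠ 0 ∧ T v = v + w ∧ T w = w := by
  have hex : ∃ n, (T - 1) ^ n = 0 := by
    have : Nontrivial (Module.End k V) := ⟨⟨T, 1, hne⟩⟩
    have : CharP (Module.End k V) p :=
      charP_of_injective_algebraMap (algebraMap k (Module.End k V)).injective p
    exact ⟨p, by rw [sub_pow_char_of_commute p (Commute.one_right T), hT, one_pow, sub_self]⟩
  classical
  obtain ⟨s, hs⟩ : ∃ s, Nat.find hex = s + 2 := by
    refine Nat.exists_eq_add_of_le' ?_
    by_contra! hlt
    have h0 := Nat.find_spec hex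
    interval_cases h : Nat.find hex
    · rw [pow_zero] at h0
      exact hne (by rw [← mul_one T, h0, mul_zero])
    · rw [pow_one] at h0
      exact hne (sub_eq_zero.mp h0)
  have h0 : (T - 1) ^ (s + 2) = 0 := hs ▸ Nat.find_spec hex
  have h1 : (T - 1) ^ (s + 1) ≠ 0 := Nat.find_min hex (by omega)
  obtain ⟨x, hx⟩ : ∃ x, ((T - 1) ^ (s + 1)) x ≠ 0 := by
    by_contra! hall
    exact h1 (LinearMap.ext hall)
  have hw : ((T - 1) ^ (s + 2)) x = 0 := by rw [h0]; rfl
  refine ⟨((T - 1) ^ s) x, ((T - 1) ^ (s + 1)) x, hx, ?_, ?_⟩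
  · rw [pow_succ']
    simp
  · rw [pow_succ', Module.End.mul_apply] at hw
    exact sub_eq_zero.mp hw

lemma sum_cast_pow_pred {k : Type*} [Field k] (p : ℕ) [Fact p.Prime] [CharP k p] :
    ∑ j : ZMod p, ((j.val : k)) ^ (p - 1) = -1 := by
  have hp := (Fact.out : p.Prime)
  have h1 (j : ZMod p) : ((j.val : k)) ^ (p - 1) = ZMod.castHom dvd_rfl k (j ^ (p - 1)) := by
    simp [ZMod.natCast_val]
  have h2 : ∑ j : ZMod p, j ^ (p - 1) = -1 := by
    have : ∀ j : ZMod p, j ^ (p - 1) = 1 - if j = 0 then 1 else 0 := by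
      intro j
      split_ifs with h
      · simp [h, Nat.sub_eq_zero_iff_le, hp.one_lt]
      · simp [ZMod.pow_card_sub_one_eq_one h]
    simp [this]
  simp_rw [h1]
  rw [← map_sum, h2, map_neg, map_one]

lemma exists_jordan_pair_rep {k : Type} [Field k] (p : ℕ) [Fact p.Prime] [CharP k p]
    (V : Rep.{0} k (Multiplicative (ZMod p))) (hnt : ∃ g v, V.ρ g v ≠ v) :
    ∃ v w : V.V, w ≠ 0 ∧ (∀ j : ZMod p, V.ρ (Multiplicative.ofAdd j) v = v + j.val • w) ∧
      ∀ g, V.ρ g w = w := by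
  set T := V.ρ (Multiplicative.ofAdd 1) with hT
  have hpow (j : ZMod p) : V.ρ (Multiplicative.ofAdd j) = T ^ j.val := by
    rw [hT, ← map_pow, ← ofAdd_nsmul]
    simp
  have hTp : T ^ p = 1 := by
    rw [hT, ← map_pow, ← ofAdd_nsmul]
    simp
  have hT1 : T ≠ 1 := by
    rintro h
    obtain ⟨g, v, hv⟩ := hnt
    refine hv ?_
    have := hpow g.toAdd
    rw [h, one_pow, ofAdd_toAdd] at this
    rw [this]
    rfl
  obtain ⟨v, w, hw, hv, hTw⟩ := exists_jordan_pair p T hTp hT1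
  refine ⟨v, w, hw, fun j => ?_, fun g => ?_⟩
  · rw [hpow]
    induction j.val with
    | zero => simp
    | succ n ih =>
      rw [pow_succ', Module.End.mul_apply, ih, map_add, map_nsmul, hv, hTw, succ_nsmul]
      abel
  · rw [← ofAdd_toAdd g, hpow]
    induction (g.toAdd).val with
    | zero => simp
    | succ n ih => rw [pow_succ', Module.End.mul_apply, ih, hTw]

lemma two_le_finrank_of_nontrivial_action {k : Type} [Field k] (p : ℕ) [Fact p.Prime] [CharP k p]
    (V : Rep.{0} k (Multiplicative (ZMod p))) [FiniteDimensional k V.V]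
    (hnt : ∃ g v, V.ρ g v ≠ v) : 2 ≤ Module.finrank k V.V := by
  obtain ⟨v, w, hw, hv, hinv⟩ := exists_jordan_pair_rep p V hnt
  by_contra! hlt
  obtain ⟨x, hx⟩ := finrank_le_one_iff.mp (Nat.le_of_lt_succ hlt)
  obtain ⟨c, rfl⟩ := hx w
  obtain ⟨d, rfl⟩ := hx v
  have hc : c ≠ 0 := left_ne_zero_of_smul hw
  have hx' : V.ρ (Multiplicative.ofAdd 1) x = x :=
    smul_right_injective _ hc (by simpa using hinv (Multiplicative.ofAdd 1))
  have := hv 1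
  rw [map_smul, hx', ZMod.val_one, one_smul] at this
  exact hw (left_eq_add.mp this)

lemma exists_norm_vecPow_ne_zero {k : Type} [Field k] (p : ℕ) [Fact p.Prime] [CharP k p]
    (V : Rep.{0} k (Multiplicative (ZMod p))) (hnt : ∃ g v, V.ρ g v ≠ v) :
    ∃ v, ∑ g, (tpow V (p - 1)).ρ g (vecPow V v (p - 1)) ≠ 0 := by
  obtain ⟨v, w, hw, hv, hinv⟩ := exists_jordan_pair_rep p V hnt
  obtain ⟨φ, hφ⟩ := Module.Projective.exists_dual_ne_zero k hw
  let u : V.V := v - (φ v * (φ w)⁻¹) • w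
  have hu : φ u = 0 := by simp [u, hφ]
  have hρu (j : ZMod p) : V.ρ (Multiplicative.ofAdd j) u = u + j.val • w := by
    simp only [u, map_sub, map_smul, hv, hinv]
    abel
  refine ⟨u, fun h0 => ?_⟩
  have h1 := congrArg (dualPow V φ (p - 1)) h0
  have hsum : ∑ g : Multiplicative (ZMod p), φ (V.ρ g u) ^ (p - 1) = - φ w ^ (p - 1) := by
    rw [← Multiplicative.ofAdd.sum_comp]
    simp_rw [hρu, map_add, hu, zero_add, map_nsmul, nsmul_eq_mul, mul_pow]
    rw [← Finset.sum_mul, sum_cast_pow_pred, neg_one_mul]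
  simp only [map_sum, map_zero, tpow_ρ_vecPow, dualPow_vecPow] at h1
  rw [hsum] at h1
  exact pow_ne_zero _ hφ (neg_eq_zero.mp h1)

/-- A sequence bounded along residues modulo `m` by powers of some `a < D ^ m` grows
exponentially at a rate less than `D`. -/
lemma limsup_rpow_inv_lt {f : ℕ → ℕ} {m a D : ℕ} (hm : 0 < m) (hD : 2 ≤ D) (ha : a < D ^ m)
    (hf : ∀ q r, f (m * q + r) ≤ a ^ q * D ^ r) :
    Filter.limsup (fun n : ℕ => (f n : ℝ) ^ ((n : ℝ)⁻¹)) Filter.atTop < D := by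
  have hm' : (0 : ℝ) < m := by exact_mod_cast hm
  have hD0 : (0 : ℝ) < D := by positivity
  set μ : ℝ := max (a : ℝ) 1 with hμ
  have hμ1 : 1 ≤ μ := le_max_right _ _
  have hμ0 : 0 < μ := by linarith
  have hμD : μ < (D : ℝ) ^ m := by
    refine max_lt (by exact_mod_cast ha) ?_
    exact one_lt_pow₀ (by exact_mod_cast hD) hm.ne'
  have hlt : μ ^ ((m : ℝ)⁻¹) < D := by
    calc μ ^ ((m : ℝ)⁻¹) < ((D : ℝ) ^ m) ^ ((m : ℝ)⁻¹) :=
          Real.rpow_lt_rpow hμ0.le hμD (by positivity)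
      _ = D := Real.pow_rpow_inv_natCast hD0.le hm.ne'
  have hbound (n : ℕ) (hn : n ≠ 0) : (f n : ℝ) ^ ((n : ℝ)⁻¹) ≤
      μ ^ ((m : ℝ)⁻¹) * ((D : ℝ) ^ m) ^ ((n : ℝ)⁻¹) := by
    have hn' : (0 : ℝ) < n := by positivity
    have h1 : (f n : ℝ) ≤ μ ^ ((n : ℝ) / m) * (D : ℝ) ^ m := by
      have h2 := hf (n / m) (n % m)
      rw [Nat.div_add_mod] at h2
      calc (f n : ℝ) ≤ (a : ℝ) ^ (n / m) * (D : ℝ) ^ (n % m) := by exact_mod_cast h2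
        _ ≤ μ ^ (n / m) * (D : ℝ) ^ m := by
          gcongr
          · exact le_max_left _ _
          · exact_mod_cast (by omega : 1 ≤ D)
          · exact (Nat.mod_lt n hm).le
        _ ≤ μ ^ ((n : ℝ) / m) * (D : ℝ) ^ m := by
          gcongr
          rw [← Real.rpow_natCast]
          exact Real.rpow_le_rpow_of_exponent_le hμ1 Nat.cast_div_le
    calc (f n : ℝ) ^ ((n : ℝ)⁻¹) ≤ (μ ^ ((n : ℝ) / m) * (D : ℝ) ^ m) ^ ((n : ℝ)⁻¹) := by
          gcongr
      _ = _ := by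
          rw [Real.mul_rpow (by positivity) (by positivity), ← Real.rpow_mul hμ0.le]
          congr 2
          field_simp
  have hlim : Filter.Tendsto (fun n : ℕ => μ ^ ((m : ℝ)⁻¹) * ((D : ℝ) ^ m) ^ ((n : ℝ)⁻¹))
      Filter.atTop (nhds (μ ^ ((m : ℝ)⁻¹))) := by
    have h := (Real.continuousAt_const_rpow (a := (D : ℝ) ^ m) (b := 0)
      (by positivity)).tendsto.comp
        (tendsto_inv_atTop_nhds_zero_nat (𝕜 := ℝ))
    simpa using h.const_mul (μ ^ ((m : ℝ)⁻¹))
  obtain ⟨c, hc, hcD⟩ := exists_between hlt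
  refine lt_of_le_of_lt (Filter.limsup_le_of_le ?_ ?_) hcD
  · exact Filter.isCoboundedUnder_le_of_le Filter.atTop (x := 0) fun n => by positivity
  · filter_upwards [hlim.eventually (gt_mem_nhds hc), Filter.eventually_ne_atTop 0] with n hn hn0
    exact (hbound n hn0).trans hn.le

/-- **Theorem.** For `G = ℤ/pℤ` over an algebraically closed field of characteristic `p`
and `V` a finite-dimensional representation on which `G` does not act trivially,
`d(G, V) < dim V`. -/
theorem dG_lt_dim_of_nontrivial_action {k : Type} [Field k] [IsAlgClosed k]
    (p : ℕ) [Fact p.Prime] [CharP k p] {V : Type} [AddCommGroup V] [Module k V]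
    [FiniteDimensional k V] (ρ : Representation k (Multiplicative (ZMod p)) V)
    (hnt : ∃ (g : Multiplicative (ZMod p)) (v : V), ρ g v ≠ v) :
    dG (Rep.of ρ) < (Module.finrank k V : ℝ) := by
  have : FiniteDimensional k (Rep.of ρ).V := ‹FiniteDimensional k V›
  have hp := (Fact.out : p.Prime)
  have hcard : (Fintype.card (Multiplicative (ZMod p)) : k) = 0 := by
    simp [ZMod.card]
  obtain ⟨v, hv⟩ := exists_norm_vecPow_ne_zero p (Rep.of ρ) hnt
  obtain ⟨a, ha, hfac⟩ := exists_factorsModTrace_lt_finrank _ _ hv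
  rw [finrank_tpow] at ha
  exact limsup_rpow_inv_lt (Nat.sub_pos_of_lt hp.one_lt)
    (two_le_finrank_of_nontrivial_action p (Rep.of ρ) hnt) ha
    fun q r => (hfac.tpow_mul_add _ q r).TS_le hcard
end
end

section
/- Let K be an algebraically closed field of characteristic p > 0 and let G be a Zariski-closed subgroup of GL_m(K) whose only unipotent element is the identity. Let G° be the identity component of G. Then the quotient group G/G° is a finite group of order prime to p (and G° is a torus). -/
open CategoryTheory MonoidalCategory Limits

noncomputable section

universe u

/-- A subset of `GL_m(k)` is Zariski closed if it is the intersection of `GL_m(k)` with the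
zero locus of a set of polynomials in the matrix entries. -/
def IsZariskiClosedGL {k : Type u} [Field k] {m : ℕ}
    (Z : Set (Matrix.GeneralLinearGroup (Fin m) k)) : Prop :=
  ∃ S : Set (MvPolynomial (Fin m × Fin m) k),
    Z = {g : Matrix.GeneralLinearGroup (Fin m) k | ∀ f ∈ S,
      MvPolynomial.eval (fun q : Fin m × Fin m => (g.val : Matrix (Fin m) (Fin m) k) q.1 q.2) f = 0}

/-- The Zariski closure of a subset of `GL_m(k)`: the smallest Zariski-closed subset
containing it. -/
def zariskiClosure {k : Type u} [Field k] {m : ℕ}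
    (X : Set (Matrix.GeneralLinearGroup (Fin m) k)) :
    Set (Matrix.GeneralLinearGroup (Fin m) k) :=
  ⋂₀ {Z | IsZariskiClosedGL Z ∧ X ⊆ Z}

/-- The Zariski topology on `GL_m(k)`. -/
def zariskiTopologyGL {k : Type u} [Field k] {m : ℕ} :
    TopologicalSpace (Matrix.GeneralLinearGroup (Fin m) k) :=
  TopologicalSpace.generateFrom {U | IsZariskiClosedGL Uᶜ}

/-- The identity component of a subset of `GL_m(k)`: the connected component of the identity
element for the Zariski topology. -/
def identityComponent {k : Type u} [Field k] {m : ℕ}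
    (X : Set (Matrix.GeneralLinearGroup (Fin m) k)) :
    Set (Matrix.GeneralLinearGroup (Fin m) k) :=
  @connectedComponentIn _ zariskiTopologyGL X 1

/-- An element of `GL_m(k)` is unipotent if `(g - 1) ^ m = 0`. -/
def IsUnipotentGL {k : Type u} [Field k] {m : ℕ} (g : Matrix.GeneralLinearGroup (Fin m) k) :
    Prop :=
  ((g.val : Matrix (Fin m) (Fin m) k) - 1) ^ m = 0

/-- The point of affine `m²`-space given by the entries of `g`. -/
abbrev entryPoint {k : Type u} {m : ℕ} (A : Matrix (Fin m) (Fin m) k) : Fin m × Fin m → k :=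
  fun q => A q.1 q.2

section ZariskiTopology

variable {k : Type u} [Field k] {m : ℕ}

/-- The point of the spectrum of the polynomial ring in the matrix entries defined by `g`. -/
def toPrimeSpectrum (g : GL (Fin m) k) :
    PrimeSpectrum (MvPolynomial (Fin m × Fin m) k) :=
  ⟨RingHom.ker (MvPolynomial.eval (entryPoint g.val)), RingHom.ker_isPrime _⟩

theorem isZariskiClosedGL_iff_exists_zeroLocus {Z : Set (GL (Fin m) k)} :
    IsZariskiClosedGL Z ↔ ∃ S, Z = toPrimeSpectrum ⁻¹' PrimeSpectrum.zeroLocus S := by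
  rfl

theorem zariskiTopologyGL_eq_induced :
    (zariskiTopologyGL : TopologicalSpace (GL (Fin m) k)) =
      TopologicalSpace.induced toPrimeSpectrum PrimeSpectrum.zariskiTopology := by
  apply le_antisymm
  · rintro U ⟨V, hV, rfl⟩
    apply TopologicalSpace.isOpen_generateFrom_of_mem
    obtain ⟨S, hS⟩ := (PrimeSpectrum.isClosed_iff_zeroLocus _).1 hV.isClosed_compl
    exact isZariskiClosedGL_iff_exists_zeroLocus.2 ⟨S, by rw [← hS]; rfl⟩
  · refine le_generateFrom fun U hU => ?_
    obtain ⟨S, hS⟩ := isZariskiClosedGL_iff_exists_zeroLocus.1 hU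
    refine ⟨(PrimeSpectrum.zeroLocus S)ᶜ, (PrimeSpectrum.isClosed_zeroLocus S).isOpen_compl, ?_⟩
    rw [Set.preimage_compl, ← hS, compl_compl]

attribute [local instance] zariskiTopologyGL

theorem isClosed_iff_isZariskiClosedGL {Z : Set (GL (Fin m) k)} :
    IsClosed Z ↔ IsZariskiClosedGL Z := by
  have h : Topology.IsInducing (toPrimeSpectrum : GL (Fin m) k → _) :=
    ⟨zariskiTopologyGL_eq_induced⟩
  rw [h.isClosed_iff, isZariskiClosedGL_iff_exists_zeroLocus]
  simp only [PrimeSpectrum.isClosed_iff_zeroLocus]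
  constructor
  · rintro ⟨_, ⟨S, rfl⟩, rfl⟩
    exact ⟨S, rfl⟩
  · rintro ⟨S, rfl⟩
    exact ⟨_, ⟨S, rfl⟩, rfl⟩

theorem noetherianSpace_generalLinearGroup :
    TopologicalSpace.NoetherianSpace (GL (Fin m) k) :=
  Topology.IsInducing.noetherianSpace (i := toPrimeSpectrum) ⟨zariskiTopologyGL_eq_induced⟩

/-- The algebra of regular functions on `GL_m`: polynomials in the matrix entries and the
inverse of the determinant. -/
def regularFunctions (k : Type u) [Field k] (m : ℕ) : Subalgebra k (GL (Fin m) k → k) where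
  carrier := {φ | ∃ (N : ℕ) (P : MvPolynomial (Fin m × Fin m) k), ∀ g : GL (Fin m) k,
    φ g * g.val.det ^ N = MvPolynomial.eval (entryPoint g.val) P}
  mul_mem' := by
    rintro φ ψ ⟨N, P, hP⟩ ⟨M, Q, hQ⟩
    refine ⟨N + M, P * Q, fun g => ?_⟩
    rw [map_mul, ← hP, ← hQ, Pi.mul_apply]
    ring
  add_mem' := by
    rintro φ ψ ⟨N, P, hP⟩ ⟨M, Q, hQ⟩
    refine ⟨N + M, P * (Matrix.mvPolynomialX (Fin m) (Fin m) k).det ^ M +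
      Q * (Matrix.mvPolynomialX (Fin m) (Fin m) k).det ^ N, fun g => ?_⟩
    have hdet : MvPolynomial.eval (entryPoint g.val) (Matrix.mvPolynomialX (Fin m) (Fin m) k).det =
        g.val.det := by
      rw [RingHom.map_det, Matrix.mvPolynomialX_mapMatrix_eval]
    rw [map_add, map_mul, map_mul, map_pow, map_pow, hdet, ← hP, ← hQ, Pi.add_apply]
    ring
  algebraMap_mem' c := ⟨0, MvPolynomial.C c, fun g => by simp⟩

theorem entry_mem_regularFunctions (i j : Fin m) :
    (fun g : GL (Fin m) k => g.val i j) ∈ regularFunctions k m :=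
  ⟨0, MvPolynomial.X (i, j), fun g => by simp⟩

theorem inv_entry_mem_regularFunctions (i j : Fin m) :
    (fun g : GL (Fin m) k => (g⁻¹).val i j) ∈ regularFunctions k m := by
  refine ⟨1, (Matrix.mvPolynomialX (Fin m) (Fin m) k).adjugate i j, fun g => ?_⟩
  have h := RingHom.map_adjugate (MvPolynomial.eval (entryPoint g.val))
    (Matrix.mvPolynomialX (Fin m) (Fin m) k)
  rw [Matrix.mvPolynomialX_mapMatrix_eval] at h
  have h' := congrFun (congrFun h i) j
  rw [RingHom.mapMatrix_apply, Matrix.map_apply] at h'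
  change (g⁻¹).val i j * _ = _
  rw [h', Matrix.coe_units_inv, Matrix.inv_def, Matrix.smul_apply, pow_one, smul_eq_mul,
    mul_right_comm, Ring.inverse_mul_cancel _ ((Matrix.isUnit_iff_isUnit_det _).1 g.isUnit),
    one_mul]

theorem isClosed_setOf_regular_eq_zero {φ : GL (Fin m) k → k} (hφ : φ ∈ regularFunctions k m) :
    IsClosed {g | φ g = 0} := by
  obtain ⟨N, P, hP⟩ := hφ
  rw [isClosed_iff_isZariskiClosedGL]
  refine ⟨{P}, Set.ext fun g => ?_⟩
  have hdet : g.val.det ≠ 0 := ((Matrix.isUnit_iff_isUnit_det _).1 g.isUnit).ne_zero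
  have := hP g
  simp only [Set.mem_ofPred_eq, Set.mem_singleton_iff, forall_eq]
  change _ ↔ MvPolynomial.eval (entryPoint g.val) P = 0
  rw [← this, mul_eq_zero, or_iff_left (pow_ne_zero N hdet)]

theorem eval_comp_mem_regularFunctions {ψ : GL (Fin m) k → GL (Fin m) k}
    (h : ∀ i j, (fun g => (ψ g).val i j) ∈ regularFunctions k m)
    (P : MvPolynomial (Fin m × Fin m) k) :
    (fun g => MvPolynomial.eval (entryPoint (ψ g).val) P) ∈ regularFunctions k m := by
  induction P using MvPolynomial.induction_on with
  | C a =>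
    simp only [MvPolynomial.eval_C]
    exact Subalgebra.algebraMap_mem _ a
  | add p q hp hq =>
    simp only [map_add]
    exact add_mem hp hq
  | mul_X p q hp =>
    simp only [map_mul, MvPolynomial.eval_X]
    exact mul_mem hp (h q.1 q.2)

theorem continuous_of_entry_mem_regularFunctions {ψ : GL (Fin m) k → GL (Fin m) k}
    (h : ∀ i j, (fun g => (ψ g).val i j) ∈ regularFunctions k m) : Continuous ψ := by
  refine continuous_iff_isClosed.2 fun Z hZ => ?_
  obtain ⟨S, rfl⟩ := isClosed_iff_isZariskiClosedGL.1 hZ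
  have : ψ ⁻¹' {g : GL (Fin m) k | ∀ f ∈ S, MvPolynomial.eval (entryPoint g.val) f = 0} =
      ⋂ f ∈ S, {g | MvPolynomial.eval (entryPoint (ψ g).val) f = 0} := by
    ext; simp
  exact this ▸ isClosed_biInter fun f _ =>
    isClosed_setOf_regular_eq_zero (eval_comp_mem_regularFunctions h f)

theorem mul_left_entry_mem_regularFunctions (a : GL (Fin m) k) (i j : Fin m) :
    (fun g : GL (Fin m) k => (a * g).val i j) ∈ regularFunctions k m := by
  convert Subalgebra.sum_mem (regularFunctions k m) (t := Finset.univ) (fun l _ =>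
    (regularFunctions k m).smul_mem (entry_mem_regularFunctions l j) (a.val i l)) using 1
  ext g
  simp [Matrix.mul_apply]

theorem mul_right_entry_mem_regularFunctions (a : GL (Fin m) k) (i j : Fin m) :
    (fun g : GL (Fin m) k => (g * a).val i j) ∈ regularFunctions k m := by
  convert Subalgebra.sum_mem (regularFunctions k m) (t := Finset.univ) (fun l _ =>
    (regularFunctions k m).smul_mem (entry_mem_regularFunctions i l) (a.val l j)) using 1
  ext g
  simp [Matrix.mul_apply, mul_comm]

theorem continuous_mul_left_zariski (a : GL (Fin m) k) : Continuous fun g => a * g :=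
  continuous_of_entry_mem_regularFunctions (mul_left_entry_mem_regularFunctions a)

theorem continuous_mul_right_zariski (a : GL (Fin m) k) : Continuous fun g => g * a :=
  continuous_of_entry_mem_regularFunctions (mul_right_entry_mem_regularFunctions a)

theorem conj_entry_mem_regularFunctions (a : GL (Fin m) k) (i j : Fin m) :
    (fun g : GL (Fin m) k => (g * a * g⁻¹).val i j) ∈ regularFunctions k m := by
  convert Subalgebra.sum_mem (regularFunctions k m) (t := Finset.univ) (fun l _ =>
    mul_mem (Subalgebra.sum_mem (regularFunctions k m) (t := Finset.univ) (fun l' _ =>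
      (regularFunctions k m).smul_mem (entry_mem_regularFunctions i l') (a.val l' l)))
      (inv_entry_mem_regularFunctions l j)) using 1
  ext g
  simp [Matrix.mul_apply, mul_comm]

theorem IsPreconnected.regular_eq_of_finite_image {X : Set (GL (Fin m) k)}
    (hX : IsPreconnected X) {φ : GL (Fin m) k → k} (hφ : φ ∈ regularFunctions k m)
    (hfin : (φ '' X).Finite) {x y : GL (Fin m) k} (hx : x ∈ X) (hy : y ∈ X) : φ x = φ y := by
  classical
  by_contra hne
  have hsub (c : k) : φ - algebraMap k _ c ∈ regularFunctions k m :=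
    sub_mem hφ (Subalgebra.algebraMap_mem _ c)
  have hT : (∏ c ∈ hfin.toFinset.erase (φ x), (φ - algebraMap k _ c)) ∈ regularFunctions k m :=
    Subalgebra.prod_mem _ fun c _ => hsub c
  have hT0 (z : GL (Fin m) k) :
      (∏ c ∈ hfin.toFinset.erase (φ x), (φ - algebraMap k _ c)) z = 0 ↔
        φ z ≠ φ x ∧ φ z ∈ φ '' X := by
    simp [Finset.prod_apply, Finset.prod_eq_zero_iff, sub_eq_zero, and_assoc]
  have hx0 (z : GL (Fin m) k) : (φ - algebraMap k (GL (Fin m) k → k) (φ x)) z = 0 ↔ φ z = φ x := by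
    simp [sub_eq_zero]
  obtain ⟨z, -, hz, hz'⟩ := isPreconnected_closed_iff.1 hX _ _
    (isClosed_setOf_regular_eq_zero (hsub (φ x))) (isClosed_setOf_regular_eq_zero hT)
    (fun z hz => by
      by_cases h : φ z = φ x
      · exact Or.inl ((hx0 z).2 h)
      · exact Or.inr ((hT0 z).2 ⟨h, z, hz, rfl⟩))
    ⟨x, hx, (hx0 x).2 rfl⟩ ⟨y, hy, (hT0 y).2 ⟨Ne.symm hne, y, hy, rfl⟩⟩
  exact ((hT0 z).1 hz').1 ((hx0 z).1 hz)

end ZariskiTopology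

section Centrality

variable {k : Type u} [Field k] {m : ℕ}

/-- The coefficients of the characteristic polynomial of the generic matrix. -/
def genericCharpolyCoeff (k : Type u) [Field k] (m i : ℕ) : MvPolynomial (Fin m × Fin m) k :=
  (Matrix.mvPolynomialX (Fin m) (Fin m) k).charpoly.coeff i

theorem eval_genericCharpolyCoeff (i : ℕ) (x : Fin m × Fin m → k) :
    MvPolynomial.eval x (genericCharpolyCoeff k m i) =
      (Matrix.of fun a b => x (a, b)).charpoly.coeff i := by
  have h := Matrix.charpoly_map (Matrix.mvPolynomialX (Fin m) (Fin m) k) (MvPolynomial.eval x)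
  rw [genericCharpolyCoeff, ← Polynomial.coeff_map, ← h]
  congr 2
  ext a b
  simp

variable [IsAlgClosed k]

/-- If the identity is the only unipotent element of the Zariski-closed set `G`, a prime ideal
containing the ideal of `G` and the equations for unipotency contains the ideal of the identity. -/
theorem ideal_one_le_of_genericCharpolyCoeff_mem {G : Set (GL (Fin m) k)}
    (hclosed : IsZariskiClosedGL G) (huni : ∀ g ∈ G, IsUnipotentGL g → g = 1)
    (q : Ideal (MvPolynomial (Fin m × Fin m) k)) [q.IsPrime]
    (hG : MvPolynomial.vanishingIdeal k ((fun g : GL (Fin m) k => entryPoint g.val) '' G) ≤ q)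
    (hq : ∀ i, genericCharpolyCoeff k m i -
      MvPolynomial.C ((1 : Matrix (Fin m) (Fin m) k).charpoly.coeff i) ∈ q) :
    MvPolynomial.vanishingIdeal k {entryPoint (1 : Matrix (Fin m) (Fin m) k)} ≤ q := by
  rw [← MvPolynomial.IsPrime.vanishingIdeal_zeroLocus (K := k) q]
  refine MvPolynomial.vanishingIdeal_anti_mono fun x hx => ?_
  set A : Matrix (Fin m) (Fin m) k := Matrix.of fun a b => x (a, b) with hA
  have hchar : A.charpoly = (1 : Matrix (Fin m) (Fin m) k).charpoly := by
    ext i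
    have := hx _ (hq i)
    rwa [map_sub, MvPolynomial.aeval_eq_eval, MvPolynomial.eval_C,
      eval_genericCharpolyCoeff, sub_eq_zero] at this
  have hdet : IsUnit A.det := by
    rw [Matrix.det_eq_sign_charpoly_coeff, hchar, ← Matrix.det_eq_sign_charpoly_coeff]
    simp
  set g : GL (Fin m) k := Matrix.GeneralLinearGroup.mkOfDetNeZero A hdet.ne_zero with hg
  have hgx : entryPoint g.val = x := rfl
  have hgG : g ∈ G := by
    obtain ⟨S, rfl⟩ := hclosed
    intro f hf
    have : f ∈ q := hG (by
      rintro _ ⟨y, hy, rfl⟩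
      simpa [MvPolynomial.aeval_eq_eval] using hy f hf)
    exact hx f this
  have hguni : IsUnipotentGL g := by
    have := Matrix.aeval_self_charpoly A
    rw [hchar, Matrix.charpoly_one] at this
    change (A - 1) ^ m = 0
    simpa using this
  rw [Set.mem_singleton_iff, ← hgx, huni g hgG hguni]
  rfl

theorem exists_finite_image_of_charpoly_eq {G : Set (GL (Fin m) k)}
    (hclosed : IsZariskiClosedGL G) (hone : 1 ∈ G) (huni : ∀ g ∈ G, IsUnipotentGL g → g = 1) :
    ∃ F : MvPolynomial (Fin m × Fin m) k,
      MvPolynomial.eval (entryPoint (1 : Matrix (Fin m) (Fin m) k)) F ≠ 0 ∧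
      (∀ c : Polynomial k, ((fun g : GL (Fin m) k => MvPolynomial.eval (entryPoint g.val) F) ''
          {g | g ∈ G ∧ g.val.charpoly = c}).Finite) ∧
      ∀ Q, ∃ n : ℕ, ∀ c : Polynomial k,
        ((fun g : GL (Fin m) k => MvPolynomial.eval (entryPoint g.val) (F ^ n * Q)) ''
          {g | g ∈ G ∧ g.val.charpoly = c}).Finite := by
  let I := MvPolynomial.vanishingIdeal k ((fun g : GL (Fin m) k => entryPoint g.val) '' G)
  let A := MvPolynomial (Fin m × Fin m) k ⧸ I
  let R : Subalgebra k A :=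
    Algebra.adjoin k (Set.range fun i => Ideal.Quotient.mk I (genericCharpolyCoeff k m i))
  have hev (g : GL (Fin m) k) (hg : g ∈ G) : ∀ a ∈ I,
      MvPolynomial.aeval (R := k) (entryPoint g.val) a = 0 :=
    fun a ha => ha _ ⟨g, hg, rfl⟩
  let ev (g : GL (Fin m) k) (hg : g ∈ G) : A →ₐ[k] k := Ideal.Quotient.liftₐ I _ (hev g hg)
  have hev_mk (g : GL (Fin m) k) (hg : g ∈ G) (a) :
      ev g hg (Ideal.Quotient.mk I a) = MvPolynomial.eval (entryPoint g.val) a := by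
    rw [← MvPolynomial.aeval_eq_eval]
    rfl
  let P : Ideal A := RingHom.ker (ev 1 hone)
  have hP : P.IsPrime := RingHom.ker_isPrime _
  have : Algebra.FiniteType R A := Algebra.FiniteType.of_restrictScalars_finiteType k R A
  have hqf : Algebra.QuasiFiniteAt R P := by
    refine Algebra.QuasiFiniteAt.of_isOpen_singleton_fiber (R := R) ⟨P, hP⟩ ?_
    convert isOpen_univ
    refine Set.eq_univ_of_forall ?_
    rintro ⟨q, hq⟩
    refine Subtype.ext ?_
    have hPq (a : A) (ha : a ∈ R) (haP : a ∈ P) : a ∈ q.asIdeal := by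
      have h : (⟨a, ha⟩ : R) ∈ (PrimeSpectrum.comap (algebraMap R A) q).asIdeal := by
        rw [Set.mem_singleton_iff.1 hq]
        exact haP
      exact h
    have hle := ideal_one_le_of_genericCharpolyCoeff_mem hclosed huni
      (q.asIdeal.comap (Ideal.Quotient.mk I))
      (fun a ha => by
        rw [Ideal.mem_comap, Ideal.Quotient.eq_zero_iff_mem.2 ha]
        exact zero_mem _)
      (fun i => by
        refine hPq _ ?_ ?_
        · rw [map_sub]
          exact sub_mem (Algebra.subset_adjoin ⟨i, rfl⟩) (R.algebraMap_mem _)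
        · refine RingHom.mem_ker.2 ((hev_mk 1 hone _).trans ?_)
          rw [map_sub, eval_genericCharpolyCoeff, MvPolynomial.eval_C]
          exact sub_self _)
    have hPmax : P.IsMaximal := RingHom.ker_isMaximal_of_surjective _ fun c =>
      ⟨algebraMap k A c, (ev 1 hone).commutes c⟩
    refine PrimeSpectrum.ext (hPmax.eq_of_le q.2.ne_top fun a ha => ?_).symm
    obtain ⟨a, rfl⟩ := Ideal.Quotient.mk_surjective a
    refine hle ?_
    rw [MvPolynomial.mem_vanishingIdeal_singleton_iff]
    exact ha
  have hfin (Q) (hQ : IsIntegral R (Ideal.Quotient.mk I Q)) (c : Polynomial k) :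
      ((fun g : GL (Fin m) k => MvPolynomial.eval (entryPoint g.val) Q) ''
        {g | g ∈ G ∧ g.val.charpoly = c}).Finite := by
    obtain ⟨p, hpm, hp⟩ := hQ
    by_cases hne : ∃ g, g ∈ G ∧ g.val.charpoly = c
    swap
    · convert Set.finite_empty
      rw [Set.image_eq_empty]
      exact Set.eq_empty_of_forall_notMem fun g hg => hne ⟨g, hg⟩
    obtain ⟨g₀, hg₀, rfl⟩ := hne
    let e (g : GL (Fin m) k) (hg : g ∈ G) : R →+* k := ((ev g hg).comp R.val).toRingHom
    have he (g : GL (Fin m) k) (hg : g ∈ G) (hc : g.val.charpoly = g₀.val.charpoly) :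
        e g hg = e g₀ hg₀ := by
      have : (ev g hg).comp R.val = (ev g₀ hg₀).comp R.val := by
        refine AlgHom.adjoin_ext ?_
        rintro _ ⟨i, rfl⟩
        refine (hev_mk g hg _).trans (Eq.trans ?_ (hev_mk g₀ hg₀ _).symm)
        rw [eval_genericCharpolyCoeff, eval_genericCharpolyCoeff]
        exact congrArg (fun p => p.coeff i) hc
      exact congrArg AlgHom.toRingHom this
    classical
    refine ((p.map (e g₀ hg₀)).roots.toFinset.finite_toSet).subset ?_
    rintro _ ⟨g, ⟨hg, hc⟩, rfl⟩
    simp only [Finset.mem_coe, Multiset.mem_toFinset]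
    rw [Polynomial.mem_roots (hpm.map _).ne_zero, ← he g hg hc, Polynomial.IsRoot.def,
      Polynomial.eval_map]
    have h := congrArg (ev g hg).toRingHom hp
    rw [Polynomial.hom_eval₂, map_zero] at h
    have h' : (ev g hg).toRingHom (Ideal.Quotient.mk I (Q)) =
        MvPolynomial.eval (entryPoint g.val) (Q) := hev_mk g hg _
    rw [h'] at h
    exact h
  obtain ⟨r, hr, hrint, hintegral⟩ := Algebra.zariskisMainProperty_iff.1
    (Algebra.ZariskisMainProperty.of_finiteType (R := R) P)
  obtain ⟨F, rfl⟩ := Ideal.Quotient.mk_surjective r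
  refine ⟨F, fun h => hr ((hev_mk 1 hone F).trans h), hfin F hrint, fun Q => ?_⟩
  obtain ⟨n, hn⟩ := hintegral (Ideal.Quotient.mk I Q)
  refine ⟨n, hfin _ ?_⟩
  rwa [map_mul, map_pow]

end Centrality

section ConnectedSubgroups

attribute [local instance] zariskiTopologyGL

variable {k : Type u} [Field k] {m : ℕ}

/-- A connected Zariski-closed linear group without nontrivial unipotents is commutative. -/
theorem commute_of_isPreconnected [IsAlgClosed k] {H : Subgroup (GL (Fin m) k)}
    (hclosed : IsZariskiClosedGL (H : Set (GL (Fin m) k)))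
    (huni : ∀ g ∈ H, IsUnipotentGL g → g = 1)
    (hconn : IsPreconnected (H : Set (GL (Fin m) k))) :
    ∀ x ∈ H, ∀ y ∈ H, x * y = y * x := by
  obtain ⟨F, hF1, hFfin, hF⟩ := exists_finite_image_of_charpoly_eq hclosed H.one_mem huni
  have hconst (g : GL (Fin m) k) (hg : g ∈ H) (Q : MvPolynomial (Fin m × Fin m) k)
      (hQ : ∀ c : Polynomial k, ((fun g : GL (Fin m) k => MvPolynomial.eval (entryPoint g.val) Q) ''
          {g | g ∈ (H : Set (GL (Fin m) k)) ∧ g.val.charpoly = c}).Finite)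
      (h : GL (Fin m) k) (hh : h ∈ H) :
      MvPolynomial.eval (entryPoint (h * g * h⁻¹).val) Q =
        MvPolynomial.eval (entryPoint g.val) Q := by
    have := hconn.regular_eq_of_finite_image
      (eval_comp_mem_regularFunctions (conj_entry_mem_regularFunctions g) Q)
      ((hQ g.val.charpoly).subset ?_) hh H.one_mem
    · simpa using this
    · rintro _ ⟨x, hx, rfl⟩
      refine ⟨x * g * x⁻¹, ⟨H.mul_mem (H.mul_mem hx hg) (H.inv_mem hx), ?_⟩, rfl⟩
      simp
  have hcentral (g : GL (Fin m) k) (hg : g ∈ H)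
      (hFg : MvPolynomial.eval (entryPoint g.val) F ≠ 0) (h : GL (Fin m) k) (hh : h ∈ H) :
      h * g = g * h := by
    suffices h * g * h⁻¹ = g from mul_inv_eq_iff_eq_mul.1 this
    have hFconst := hconst g hg F hFfin h hh
    ext i j
    obtain ⟨n, hn⟩ := hF (MvPolynomial.X (i, j))
    have h1 := hconst g hg _ hn h hh
    rw [map_mul, map_mul, map_pow, map_pow, hFconst, MvPolynomial.eval_X, MvPolynomial.eval_X]
      at h1
    exact mul_left_cancel₀ (pow_ne_zero n hFg) h1
  by_contra! hne
  obtain ⟨y, hy, x, hx, hyx⟩ := hne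
  let Z : Subgroup (GL (Fin m) k) := Subgroup.centralizer H
  have hZ : IsClosed (Z : Set (GL (Fin m) k)) := by
    have hZeq : (Z : Set (GL (Fin m) k)) = ⋂ h ∈ H, ⋂ i, ⋂ j,
        {g | (h * g).val i j - (g * h).val i j = 0} := by
      ext g
      simp only [SetLike.mem_coe, Z, Subgroup.mem_centralizer_iff, Set.mem_iInter,
        Set.mem_ofPred_eq, sub_eq_zero]
      exact forall₂_congr fun h _ => ⟨fun e i j => by rw [e], fun e => Units.ext (Matrix.ext e)⟩
    rw [hZeq]
    exact isClosed_biInter fun h _ => isClosed_iInter fun i => isClosed_iInter fun j =>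
      isClosed_setOf_regular_eq_zero (sub_mem (mul_left_entry_mem_regularFunctions h i j)
        (mul_right_entry_mem_regularFunctions h i j))
  have hT : IsClosed (⋂ z ∈ Z ⊓ H,
      {g : GL (Fin m) k | MvPolynomial.eval (entryPoint (z⁻¹ * g).val) F = 0}) :=
    isClosed_biInter fun z _ => isClosed_setOf_regular_eq_zero
      (eval_comp_mem_regularFunctions (mul_left_entry_mem_regularFunctions z⁻¹) F)
  have hcover : ∀ g ∈ H, g ∉ Z → g ∈ (⋂ z ∈ Z ⊓ H,
      {g : GL (Fin m) k | MvPolynomial.eval (entryPoint (z⁻¹ * g).val) F = 0}) := by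
    intro g hg hgZ
    simp only [Set.mem_iInter]
    intro z hz
    by_contra hne
    refine hgZ ?_
    have hmem := H.mul_mem (H.inv_mem hz.2) hg
    have : z⁻¹ * g ∈ Z := Subgroup.mem_centralizer_iff.2 (hcentral _ hmem hne)
    simpa using Z.mul_mem hz.1 this
  obtain ⟨z, hzH, hz, hz'⟩ := isPreconnected_closed_iff.1 hconn _ _ hZ hT
    (fun g hg => or_iff_not_imp_left.2 (hcover g hg)) ⟨1, H.one_mem, Z.one_mem⟩
    ⟨y, hy, hcover y hy fun h => hyx (Subgroup.mem_centralizer_iff.1 h x hx).symm⟩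
  have : MvPolynomial.eval (entryPoint (z⁻¹ * z).val) F = 0 := Set.mem_iInter₂.1 hz' z ⟨hz, hzH⟩
  rw [inv_mul_cancel] at this
  exact hF1 this

end ConnectedSubgroups

section Diagonalization

variable {k : Type u} [Field k] {m : ℕ}

/-- Commuting semisimple matrices over an algebraically closed field are simultaneously
diagonalizable. -/
theorem exists_isDiag_conj_of_commute [IsAlgClosed k] (X : Set (Matrix (Fin m) (Fin m) k))
    (hcomm : ∀ x ∈ X, ∀ y ∈ X, x * y = y * x)
    (hss : ∀ x ∈ X, Module.End.IsSemisimple (Matrix.toLin' x)) :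
    ∃ u : GL (Fin m) k, ∀ x ∈ X, (u.val * x * (u⁻¹).val).IsDiag := by
  let f : X → Module.End k (Fin m → k) := fun x => Matrix.toLin' x.1
  have hf : Pairwise fun x y => Commute (f x) (f y) := fun x y _ => by
    change Matrix.toLin' x.1 * Matrix.toLin' y.1 = Matrix.toLin' y.1 * Matrix.toLin' x.1
    rw [Module.End.mul_eq_comp, Module.End.mul_eq_comp, ← Matrix.toLin'_mul, ← Matrix.toLin'_mul,
      hcomm x x.2 y y.2]
  have htop :=
    Module.End.iSup_iInf_maxGenEigenspace_eq_top_of_iSup_maxGenEigenspace_eq_top_of_commute f hf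
      (fun x => Module.End.iSup_maxGenEigenspace_eq_top _)
  let E : Set (Fin m → k) := {v | ∀ x ∈ X, ∃ c : k, x.mulVec v = c • v}
  have hE : ⊤ ≤ Submodule.span k E := by
    rw [← htop]
    refine iSup_le fun χ v hv => Submodule.subset_span fun x hx => ⟨χ ⟨x, hx⟩, ?_⟩
    have := (Submodule.mem_iInf _).1 hv ⟨x, hx⟩
    rw [(Module.End.isFinitelySemisimple_iff_isSemisimple.mpr
      (hss x hx)).maxGenEigenspace_eq_eigenspace, Module.End.mem_eigenspace_iff] at this
    exact this
  let b₀ := Module.Basis.ofSpan hE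
  let e := b₀.indexEquiv (Pi.basisFun k (Fin m))
  let b := b₀.reindex e
  have hb : ∀ j, b j ∈ E := fun j => by
    rw [Module.Basis.reindex_apply]
    exact Module.Basis.ofSpan_subset hE ⟨_, rfl⟩
  let P := (Pi.basisFun k (Fin m)).toMatrix b
  let Q := b.toMatrix (Pi.basisFun k (Fin m))
  have hQP : Q * P = 1 := b.toMatrix_mul_toMatrix_flip _
  refine ⟨⟨Q, P, hQP, (Pi.basisFun k (Fin m)).toMatrix_mul_toMatrix_flip b⟩, fun x hx => ?_⟩
  choose c hc using fun j => hb j x hx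
  have hxP : x * P = P * Matrix.diagonal c := by
    ext i j
    rw [Matrix.mul_diagonal, mul_comm]
    exact congrFun (hc j) i
  change (Q * x * P).IsDiag
  rw [mul_assoc, hxP, ← mul_assoc, hQP, one_mul]
  exact Matrix.isDiag_diagonal c

/-- The algebra of linear combinations of geometric sequences. -/
def geometricSums (k : Type u) [Field k] : Subalgebra k (ℕ → k) :=
  (MonoidAlgebra.lift k (ℕ → k) k
    { toFun := fun a j => a ^ j
      map_one' := funext fun j => one_pow j
      map_mul' := fun a b => funext fun j => mul_pow a b j }).range

theorem pow_mem_geometricSums (a : k) : (fun j => a ^ j) ∈ geometricSums k :=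
  ⟨MonoidAlgebra.of k k a, by
    change MonoidAlgebra.lift k (ℕ → k) k _ _ = _
    rw [MonoidAlgebra.lift_of]
    rfl⟩

theorem apply_one_eq_zero_of_mem_geometricSums {q : ℕ} (hq : Function.Injective fun a : k => a ^ q)
    {φ : ℕ → k} (hφ : φ ∈ geometricSums k) (h : ∀ n, φ (q * n) = 0) : φ 1 = 0 := by
  classical
  obtain ⟨F, rfl⟩ := hφ
  rw [AlgHom.toRingHom_eq_coe, RingHom.coe_coe, MonoidAlgebra.lift_apply] at h ⊢
  let S := F.coeff.support
  have hφ : ∀ j, (F.coeff.sum fun a b => b • fun j => a ^ j) j = ∑ a ∈ S, F.coeff a * a ^ j := by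
    intro j
    rw [Finsupp.sum, Finset.sum_apply]
    rfl
  let P := Lagrange.interpolate S (fun a => a ^ q) id
  have hP : ∀ a ∈ S, ∑ n ∈ P.support, P.coeff n * (a ^ q) ^ n = a := fun a ha => by
    have := Lagrange.eval_interpolate_at_node (r := id) hq.injOn ha
    rwa [Polynomial.eval_eq_sum] at this
  refine (hφ 1).trans ?_
  calc ∑ a ∈ S, F.coeff a * a ^ 1
      = ∑ a ∈ S, F.coeff a * ∑ n ∈ P.support, P.coeff n * (a ^ q) ^ n :=
        Finset.sum_congr rfl fun a ha => by rw [hP a ha, pow_one]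
    _ = ∑ n ∈ P.support, P.coeff n * ∑ a ∈ S, F.coeff a * a ^ (q * n) := by
        simp_rw [Finset.mul_sum]
        rw [Finset.sum_comm]
        exact Finset.sum_congr rfl fun n _ => Finset.sum_congr rfl fun a _ => by
          rw [pow_mul]; ring
    _ = 0 := Finset.sum_eq_zero fun n _ => by
        rw [← hφ]
        exact mul_eq_zero_of_right _ (h n)

theorem pow_entry_mem_geometricSums [IsAlgClosed k] {s : Matrix (Fin m) (Fin m) k}
    (hs : Module.End.IsSemisimple (Matrix.toLin' s)) (i j : Fin m) :
    (fun n => (s ^ n) i j) ∈ geometricSums k := by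
  obtain ⟨u, hu⟩ := exists_isDiag_conj_of_commute {s}
    (by rintro _ rfl _ rfl; rfl) (by rintro _ rfl; exact hs)
  obtain ⟨d, hd⟩ : ∃ d : Fin m → k, u.val * s * (u⁻¹).val = Matrix.diagonal d :=
    ⟨_, ((hu s rfl).diagonal_diag).symm⟩
  have hpow : ∀ n, s ^ n = (u⁻¹).val * Matrix.diagonal (d ^ n) * u.val := fun n => by
    rw [← Matrix.diagonal_pow, ← hd, Units.conj_pow, mul_assoc, mul_assoc, mul_assoc,
      Units.inv_mul, mul_one, Units.inv_mul_cancel_left]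
  have : (fun n => (s ^ n) i j) =
      ∑ l, ((u⁻¹).val i l * u.val l j) • fun n => d l ^ n := by
    ext n
    rw [hpow, Matrix.mul_apply, Finset.sum_apply]
    refine Finset.sum_congr rfl fun l _ => ?_
    rw [Matrix.mul_diagonal, Pi.smul_apply, Pi.pow_apply, smul_eq_mul]
    ring
  rw [this]
  exact sum_mem fun l _ => Subalgebra.smul_mem _ (pow_mem_geometricSums _) _

theorem mem_of_forall_pow_mul_mem [IsAlgClosed k] {q : ℕ}
    (hq : Function.Injective fun a : k => a ^ q) {s : GL (Fin m) k}
    (hs : Module.End.IsSemisimple (Matrix.toLin' s.val)) {Z : Set (GL (Fin m) k)}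
    (hZ : IsZariskiClosedGL Z) (h : ∀ n, s ^ (q * n) ∈ Z) : s ∈ Z := by
  obtain ⟨S, rfl⟩ := hZ
  intro f hf
  have hmem : (fun n => MvPolynomial.eval (entryPoint (s.val ^ n)) f) ∈ geometricSums k := by
    clear h hf
    induction f using MvPolynomial.induction_on with
    | C a =>
      simp only [MvPolynomial.eval_C]
      exact Subalgebra.algebraMap_mem _ a
    | add a b ha hb =>
      simp only [map_add]
      exact add_mem ha hb
    | mul_X a l ha =>
      simp only [map_mul, MvPolynomial.eval_X]
      exact mul_mem ha (pow_entry_mem_geometricSums hs l.1 l.2)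
  have := apply_one_eq_zero_of_mem_geometricSums hq hmem fun n => by
    have := h n f hf
    rwa [Units.val_pow_eq_pow_val] at this
  rwa [pow_one] at this

end Diagonalization

section JordanDecomposition

variable {k : Type u} [Field k] {m : ℕ}

theorem Matrix.pow_eq_zero_of_isNilpotent {A : Matrix (Fin m) (Fin m) k} (hA : IsNilpotent A) :
    A ^ m = 0 := by
  have h : IsNilpotent (Matrix.toLinAlgEquiv' A) := hA.map _
  have h' := LinearMap.aeval_self_charpoly (Matrix.toLinAlgEquiv' A)
  rw [h.charpoly_eq_X_pow_finrank, Module.finrank_fin_fun, map_pow, Polynomial.aeval_X,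
    ← map_pow, EmbeddingLike.map_eq_zero_iff] at h'
  exact h'

/-- The additive Jordan decomposition of a matrix. -/
theorem Matrix.exists_add_isNilpotent_isSemisimple [IsAlgClosed k] (A : Matrix (Fin m) (Fin m) k) :
    ∃ N S : Matrix (Fin m) (Fin m) k, A = N + S ∧ Commute N S ∧ IsNilpotent N ∧
      Module.End.IsSemisimple (Matrix.toLin' S) := by
  obtain ⟨n, hn, s, hs, hnil, hss, h⟩ :=
    Module.End.exists_isNilpotent_isSemisimple (f := Matrix.toLinAlgEquiv' A)
  have hcomm : Commute n s := Algebra.commute_of_mem_adjoin_singleton_of_commute hs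
    (Algebra.commute_of_mem_adjoin_self hn).symm
  refine ⟨Matrix.toLinAlgEquiv'.symm n, Matrix.toLinAlgEquiv'.symm s, ?_, hcomm.map _,
    hnil.map _, ?_⟩
  · rw [← map_add, ← h, AlgEquiv.symm_apply_apply]
  · change Module.End.IsSemisimple (Matrix.toLinAlgEquiv' (Matrix.toLinAlgEquiv'.symm s))
    rwa [AlgEquiv.apply_symm_apply]

theorem pow_left_injective_of_charP (p : ℕ) [Fact p.Prime] [CharP k p] (e : ℕ) :
    Function.Injective fun a : k => a ^ p ^ e :=
  iterateFrobenius_inj k p e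

/-- A Zariski closed subgroup without nontrivial unipotents consists of semisimple elements. -/
theorem isSemisimple_of_forall_isUnipotentGL_eq_one [IsAlgClosed k] (p : ℕ) [Fact p.Prime]
    [CharP k p] {G : Subgroup (GL (Fin m) k)} (hclosed : IsZariskiClosedGL (G : Set (GL (Fin m) k)))
    (huni : ∀ g ∈ G, IsUnipotentGL g → g = 1) {g : GL (Fin m) k} (hg : g ∈ G) :
    Module.End.IsSemisimple (Matrix.toLin' g.val) := by
  obtain ⟨N, S, hNS, hcomm, hN, hS⟩ := Matrix.exists_add_isNilpotent_isSemisimple g.val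
  rcases isEmpty_or_nonempty (Fin m) with hm | hm
  · rwa [Subsingleton.elim g.val S]
  have hpow : g.val ^ p ^ m = S ^ p ^ m := by
    rw [hNS, add_pow_char_pow_of_commute p m hcomm, pow_eq_zero_of_le
      (Nat.lt_pow_self (Fact.out : p.Prime).one_lt).le (Matrix.pow_eq_zero_of_isNilpotent hN),
      zero_add]
  have hunit : IsUnit S := by
    rw [← isUnit_pow_iff (pow_ne_zero m (Fact.out : p.Prime).ne_zero), ← hpow]
    exact g.isUnit.pow _
  obtain ⟨s, rfl⟩ := hunit
  have hgs : g ^ p ^ m = s ^ p ^ m := Units.ext hpow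
  have hs : s ∈ G := mem_of_forall_pow_mul_mem (pow_left_injective_of_charP p m) hS hclosed
    fun n => by
      rw [pow_mul, ← hgs]
      exact G.pow_mem (G.pow_mem hg _) n
  have huni' : IsUnipotentGL (s⁻¹ * g) := by
    have : (s⁻¹ * g).val - 1 = (s⁻¹).val * N := by
      rw [Units.val_mul, hNS, mul_add, Units.inv_mul, add_sub_cancel_right]
    rw [IsUnipotentGL, this, (hcomm.symm.units_inv_left).mul_pow,
      Matrix.pow_eq_zero_of_isNilpotent hN, mul_zero]
  have : g = s := by
    rw [← inv_mul_eq_one.1 (huni _ (G.mul_mem (G.inv_mem hs) hg) huni')]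
  rwa [this]

end JordanDecomposition

section IdentityComponent

variable {k : Type u} [Field k] {m : ℕ}

attribute [local instance] zariskiTopologyGL

theorem isClosed_identityComponent {X : Set (GL (Fin m) k)} (hX : IsClosed X) :
    IsClosed (identityComponent X) := by
  by_cases h1 : (1 : GL (Fin m) k) ∈ X
  · rw [← closure_subset_iff_isClosed]
    exact isPreconnected_connectedComponentIn.closure.subset_connectedComponentIn
      (subset_closure (mem_connectedComponentIn h1))
      (closure_minimal (connectedComponentIn_subset X 1) hX)
  · rw [identityComponent, connectedComponentIn_eq_empty h1]
    exact isClosed_empty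

/-- Two elements of a preconnected subset of `G` differ by an element of the identity component
of `G`. -/
theorem inv_mul_mem_identityComponent {G : Subgroup (GL (Fin m) k)} {C : Set (GL (Fin m) k)}
    (hC : IsPreconnected C) (hCG : C ⊆ G) {x y : GL (Fin m) k} (hx : x ∈ C) (hy : y ∈ C) :
    x⁻¹ * y ∈ identityComponent (G : Set (GL (Fin m) k)) := by
  refine (hC.image _ (continuous_mul_left_zariski x⁻¹).continuousOn).subset_connectedComponentIn
    ⟨x, hx, inv_mul_cancel x⟩ ?_ ⟨y, hy, rfl⟩
  rintro _ ⟨z, hz, rfl⟩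
  exact G.mul_mem (G.inv_mem (hCG hx)) (hCG hz)

variable {G : Subgroup (GL (Fin m) k)} {G0 : Subgroup G}

theorem normal_of_coe_eq_identityComponent
    (hG0 : (G0 : Set G) = {x : G | (x : GL (Fin m) k) ∈
      identityComponent (G : Set (GL (Fin m) k))}) : G0.Normal := by
  have hmem : ∀ x : G, x ∈ G0 ↔ (x : GL (Fin m) k) ∈ identityComponent (G : Set (GL (Fin m) k)) :=
    fun x => Set.ext_iff.1 hG0 x
  refine ⟨fun n hn g => (hmem _).2 ?_⟩
  have hconn := ((isPreconnected_connectedComponentIn (F := (G : Set (GL (Fin m) k)))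
    (x := 1)).image _ (continuous_mul_left_zariski g.1).continuousOn).image _
      (continuous_mul_right_zariski g.1⁻¹).continuousOn
  refine hconn.subset_connectedComponentIn ⟨_, ⟨1, mem_connectedComponentIn G.one_mem, rfl⟩, ?_⟩ ?_
    ⟨_, ⟨n, (hmem n).1 hn, rfl⟩, rfl⟩
  · simp
  · rintro _ ⟨_, ⟨z, hz, rfl⟩, rfl⟩
    exact G.mul_mem (G.mul_mem g.2 (connectedComponentIn_subset _ _ hz)) (G.inv_mem g.2)

theorem finite_quotient_of_coe_eq_identityComponent
    (hG0 : (G0 : Set G) = {x : G | (x : GL (Fin m) k) ∈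
      identityComponent (G : Set (GL (Fin m) k))}) : Finite (G ⧸ G0) := by
  have := noetherianSpace_generalLinearGroup (k := k) (m := m)
  have hind : Topology.IsInducing (Subtype.val : G → GL (Fin m) k) :=
    Topology.IsInducing.subtypeVal
  have := hind.noetherianSpace
  have := (TopologicalSpace.NoetherianSpace.finite_irreducibleComponents (α := G)).to_subtype
  refine Finite.of_injective (fun x : G ⧸ G0 => (⟨irreducibleComponent x.out,
    irreducibleComponent_mem_irreducibleComponents _⟩ : irreducibleComponents G)) fun x y hxy => ?_
  have hC := (isIrreducible_irreducibleComponent (x := x.out)).isPreirreducible.isPreconnected.image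
    _ continuous_subtype_val.continuousOn
  rw [← x.out_eq', ← y.out_eq']
  refine QuotientGroup.eq.2 ((Set.ext_iff.1 hG0 _).2 (inv_mul_mem_identityComponent hC ?_
    ⟨_, mem_irreducibleComponent, rfl⟩ ⟨y.out, ?_, rfl⟩))
  · rintro _ ⟨z, -, rfl⟩
    exact z.2
  · rw [show irreducibleComponent x.out = irreducibleComponent y.out from congrArg Subtype.val hxy]
    exact mem_irreducibleComponent

end IdentityComponent

/-- **Proposition.** Let `G ≤ GL_m(k)` be Zariski closed, `k` algebraically closed of
characteristic `p > 0`, whose only unipotent element is the identity. Then the identity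
component `G°` has finite index in `G` prime to `p` (and `G°` is a torus, i.e. it is
simultaneously diagonalizable). -/
theorem index_of_identityComponent_prime_to_p {k : Type u} [Field k] [IsAlgClosed k]
    (p : ℕ) (hp : 0 < p) [CharP k p] {m : ℕ}
    (G : Subgroup (Matrix.GeneralLinearGroup (Fin m) k))
    (hclosed : IsZariskiClosedGL (G : Set (Matrix.GeneralLinearGroup (Fin m) k)))
    (huni : ∀ g ∈ G, IsUnipotentGL g → g = 1)
    (G0 : Subgroup G)
    (hG0 : (G0 : Set G) = {x : G | (x : Matrix.GeneralLinearGroup (Fin m) k) ∈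
      identityComponent (G : Set (Matrix.GeneralLinearGroup (Fin m) k))}) :
    (G0.index ≠ 0 ∧ ¬ p ∣ G0.index) ∧
      ∃ u : Matrix.GeneralLinearGroup (Fin m) k,
        ∀ x ∈ identityComponent (G : Set (Matrix.GeneralLinearGroup (Fin m) k)),
          ((u * x * u⁻¹ : Matrix.GeneralLinearGroup (Fin m) k).val).IsDiag := by
  have hprime : p.Prime := (CharP.char_is_prime_or_zero k p).resolve_right hp.ne'
  have : Fact p.Prime := ⟨hprime⟩
  have hcl := isClosed_iff_isZariskiClosedGL.1
    (isClosed_identityComponent (isClosed_iff_isZariskiClosedGL.2 hclosed))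
  have hmem : ∀ x : G, x ∈ G0 ↔ (x : GL (Fin m) k) ∈ identityComponent (G : Set (GL (Fin m) k)) :=
    fun x => Set.ext_iff.1 hG0 x
  have hss := fun g hg => isSemisimple_of_forall_isUnipotentGL_eq_one p hclosed huni (g := g) hg
  have := normal_of_coe_eq_identityComponent hG0
  have := finite_quotient_of_coe_eq_identityComponent hG0
  refine ⟨⟨Nat.card_pos.ne', fun hdvd => ?_⟩, ?_⟩
  · obtain ⟨x, hx⟩ := exists_prime_orderOf_dvd_card' p hdvd
    obtain ⟨g, rfl⟩ := QuotientGroup.mk_surjective x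
    have hgp : g ^ p ∈ G0 := by
      rw [← QuotientGroup.eq_one_iff, QuotientGroup.mk_pow, ← hx, pow_orderOf_eq_one]
    have hg : g ∈ G0 := (hmem g).2 <|
      mem_of_forall_pow_mul_mem (q := p) (by simpa using pow_left_injective_of_charP p 1)
        (hss g g.2) hcl fun n => by
          have := (hmem _).1 (G0.pow_mem hgp n)
          rwa [← pow_mul] at this
    rw [(QuotientGroup.eq_one_iff g).2 hg, orderOf_one] at hx
    exact hprime.one_lt.ne hx
  · have hsub : identityComponent (G : Set (GL (Fin m) k)) ⊆ G :=
      @connectedComponentIn_subset _ zariskiTopologyGL _ _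
    have hH : ((G0.map G.subtype : Subgroup _) : Set (GL (Fin m) k)) =
        identityComponent (G : Set (GL (Fin m) k)) := by
      rw [Subgroup.coe_map, hG0]
      exact Subtype.coe_image_of_subset hsub
    have hcomm := commute_of_isPreconnected (H := G0.map G.subtype) (hH ▸ hcl)
      (fun g hg => huni g (hsub (hH ▸ hg)))
      (by rw [hH]; exact @isPreconnected_connectedComponentIn _ zariskiTopologyGL _ _)
    simp only [← SetLike.mem_coe, hH] at hcomm
    obtain ⟨u, hu⟩ := exists_isDiag_conj_of_commute
      (Units.val '' identityComponent (G : Set (GL (Fin m) k)))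
      (by
        rintro _ ⟨x, hx, rfl⟩ _ ⟨y, hy, rfl⟩
        exact congrArg Units.val (hcomm x hx y hy))
      (by
        rintro _ ⟨x, hx, rfl⟩
        exact hss x (hsub hx))
    exact ⟨u, fun x hx => hu _ ⟨x, hx, rfl⟩⟩
end
end

section
/- Let K be an algebraically closed field of characteristic p > 0, let V be an m-dimensional vector space over K, and let G be a Zariski-closed subgroup of GL(V). If the only unipotent element of G is the identity and the image of the determinant map restricted to G is finite, then d(G, V) = m. -/
open CategoryTheory MonoidalCategory Limits

noncomputable section

universe u

/-- The representation on `k^m` induced by a group homomorphism to `GL_m(k)`. -/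
def matRep {k G : Type u} [Field k] [Monoid G] {m : ℕ}
    (ρ : G →* Matrix.GeneralLinearGroup (Fin m) k) : Representation k G (Fin m → k) :=
  (Matrix.toLinAlgEquiv'.toRingEquiv.toRingHom.toMonoidHom).comp
    ((Units.coeHom (Matrix (Fin m) (Fin m) k)).comp ρ)

section TensorPower

variable {R S : Type*} [CommRing R] [CommRing S] {ι : Type*} [Fintype ι] [DecidableEq ι]

/-- The matrix of the tensor power `A^{⊗ α}` in the basis of words `α → ι`. -/
def tensorPowMatrix (α : Type*) [Fintype α] [DecidableEq α] :
    Matrix ι ι R →* Matrix (α → ι) (α → ι) R where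
  toFun A := Matrix.of fun w w' => ∏ i, A (w i) (w' i)
  map_one' := by
    ext w w'
    simp only [Matrix.of_apply, Matrix.one_apply, Finset.prod_ite_zero, Finset.prod_const_one,
      Finset.mem_univ, forall_const, funext_iff]
  map_mul' A B := by
    ext w w'
    simp only [Matrix.of_apply, Matrix.mul_apply, Fintype.prod_sum, Finset.prod_mul_distrib]

variable {α : Type*} [Fintype α] [DecidableEq α]

lemma tensorPowMatrix_apply (A : Matrix ι ι R) (w w' : α → ι) :
    tensorPowMatrix α A w w' = ∏ i, A (w i) (w' i) := rfl

lemma tensorPowMatrix_map (f : R →+* S) (A : Matrix ι ι R) :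
    tensorPowMatrix α (A.map f) = (tensorPowMatrix α A).map f := by
  ext w w'
  simp [tensorPowMatrix_apply]

end TensorPower

section FiniteGroup

lemma Matrix.pow_card_eq_zero_of_isNilpotent {F : Type*} [Field F] {m : ℕ}
    {A : Matrix (Fin m) (Fin m) F} (hA : IsNilpotent A) : A ^ m = 0 := by
  have h := (LinearMap.isNilpotent_iff_charpoly (Matrix.toLin' A)).1
    (hA.map (Matrix.toLinAlgEquiv' : Matrix (Fin m) (Fin m) F ≃ₐ[F] _))
  have h2 := LinearMap.aeval_self_charpoly (Matrix.toLin' A)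
  rw [h, map_pow, Polynomial.aeval_X, Module.finrank_fin_fun] at h2
  apply (Matrix.toLinAlgEquiv' : Matrix (Fin m) (Fin m) F ≃ₐ[F] _).injective
  rw [map_pow, map_zero]
  exact h2

lemma card_ne_zero_of_no_unipotent {F : Type u} [Field F] [Finite F] (p : ℕ) [Fact p.Prime]
    [CharP F p] {m : ℕ} (H : Subgroup (Matrix.GeneralLinearGroup (Fin m) F))
    (hH : ∀ h ∈ H, IsUnipotentGL h → h = 1) : (Nat.card H : F) ≠ 0 := by
  rw [Ne, CharP.cast_eq_zero_iff F p]
  intro hdvd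
  obtain ⟨h, hh⟩ := exists_prime_orderOf_dvd_card' p hdvd
  have h1 : h.1 = 1 := by
    refine hH h.1 h.2 (Matrix.pow_card_eq_zero_of_isNilpotent ⟨p, ?_⟩)
    have : CharP (Matrix (Fin m) (Fin m) F) p ∨ m = 0 := by
      rcases Nat.eq_zero_or_pos m with h0 | h0
      · exact Or.inr h0
      · have : Nonempty (Fin m) := ⟨⟨0, h0⟩⟩
        exact Or.inl inferInstance
    rcases this with _ | rfl
    · rw [sub_pow_char_of_commute p (Commute.one_right _), one_pow, ← Units.val_pow_eq_pow_val]
      have : h.1 ^ p = 1 := by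
        have := pow_orderOf_eq_one h
        rw [hh] at this
        exact_mod_cast congrArg Subtype.val this
      rw [this, Units.val_one, sub_self]
    · exact Subsingleton.elim _ _
  have : h = 1 := Subtype.ext h1
  rw [this, orderOf_one] at hh
  exact (Fact.out : p.Prime).one_lt.ne hh

lemma exists_fixed_of_finite {F : Type u} [Field F] {m : ℕ}
    (H : Subgroup (Matrix.GeneralLinearGroup (Fin m) F)) [Finite H]
    (hH : (Nat.card H : F) ≠ 0) {W : Type*} [Fintype W] [DecidableEq W]
    (T : Matrix (Fin m) (Fin m) F →* Matrix W W F) (φ : W → F) (hφ : φ ≠ 0)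
    (hinv : ∀ h ∈ H, Matrix.vecMul φ (T h.val) = φ) :
    ∃ x : W → F, (∀ h ∈ H, Matrix.mulVec (T h.val) x = x) ∧ φ ⬝ᵥ x ≠ 0 := by
  obtain ⟨w, hw⟩ := Function.ne_iff.1 hφ
  have := Fintype.ofFinite H
  refine ⟨∑ h : H, Matrix.mulVec (T h.1.val) (Pi.single w 1), fun h hh => ?_, ?_⟩
  · rw [Matrix.mulVec_sum]
    refine Fintype.sum_equiv (Equiv.mulLeft (⟨h, hh⟩ : H)) _ _ fun a => ?_
    rw [Matrix.mulVec_mulVec, ← map_mul]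
    rfl
  · rw [dotProduct_sum]
    simp only [Matrix.dotProduct_mulVec, fun h : H => hinv h.1 h.2, dotProduct_single, mul_one,
      Finset.sum_const, Finset.card_univ, nsmul_eq_mul]
    rw [← Nat.card_eq_fintype_card]
    exact mul_ne_zero hH hw

end FiniteGroup
section Specialization

lemma exists_specialization {k : Type u} [Field k] (p : ℕ) [Fact p.Prime] [CharP k p]
    {C : Set k} (hC : C.Finite) :
    ∃ R : Subring k, C ⊆ R ∧ ∃ (F : Type u) (_ : Field F) (_ : Finite F) (_ : CharP F p),
      Nonempty (R →+* F) := by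
  let := ZMod.algebra k p
  let A : Subalgebra (ZMod p) k := Algebra.adjoin (ZMod p) C
  have hA : Algebra.FiniteType (ZMod p) A :=
    A.fg_iff_finiteType.1 ⟨hC.toFinset, by simp [A]⟩
  obtain ⟨M, hM⟩ := Ideal.exists_maximal A
  let : Field (A ⧸ M) := Ideal.Quotient.field M
  have : Module.Finite (ZMod p) (A ⧸ M) :=
    finite_of_finite_type_of_isJacobsonRing (ZMod p) (A ⧸ M)
  refine ⟨A.toSubring, Algebra.subset_adjoin, A ⧸ M, inferInstance,
    Module.finite_of_finite (ZMod p),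
      charP_of_injective_ringHom (algebraMap (ZMod p) (A ⧸ M)).injective p,
    ⟨Ideal.Quotient.mk M⟩⟩

open MvPolynomial in
/-- A polynomial in the radical of a finitely generated ideal stays so over every subring
containing a suitable finite set of coefficients. -/
lemma exists_finite_coeffs_of_mem_radical {k : Type*} [Field k] {σ ι : Type*} [Finite ι]
    {P : MvPolynomial σ k} {Q : ι → MvPolynomial σ k}
    (h : P ∈ (Ideal.span (Set.range Q)).radical) :
    ∃ C : Set k, C.Finite ∧ ∀ R : Subring k, C ⊆ R → ∀ (P' : MvPolynomial σ R)
      (Q' : ι → MvPolynomial σ R), map R.subtype P' = P → (∀ i, map R.subtype (Q' i) = Q i) →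
      P' ∈ (Ideal.span (Set.range Q')).radical := by
  have := Fintype.ofFinite ι
  obtain ⟨N, hN⟩ := h
  obtain ⟨a, ha⟩ := Ideal.mem_span_range_iff_exists_fun.1 hN
  refine ⟨⋃ i, (a i).coeffs, Set.finite_iUnion fun i => Finset.finite_toSet _, ?_⟩
  intro R hR P' Q' hP hQ
  have : ∀ i, ∃ a' : MvPolynomial σ R, map R.subtype a' = a i := by
    intro i
    have : a i ∈ Set.range (map (σ := σ) R.subtype) := by
      rw [mem_range_map_iff_coeffs_subset]
      intro c hc
      exact ⟨⟨c, hR (Set.mem_iUnion.2 ⟨i, hc⟩)⟩, rfl⟩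
    exact this
  choose a' ha' using this
  refine ⟨N, Ideal.mem_span_range_iff_exists_fun.2 ⟨a', ?_⟩⟩
  apply map_injective R.subtype Subtype.val_injective
  simp [ha', hQ, hP, ha]

open MvPolynomial in
lemma eval₂_eq_zero_of_mem_radical {R F : Type*} [CommRing R] [Field F] {σ ι : Type*}
    {P : MvPolynomial σ R} {Q : ι → MvPolynomial σ R}
    (h : P ∈ (Ideal.span (Set.range Q)).radical) (s : R →+* F) (x : σ → F)
    (hx : ∀ i, eval₂ s x (Q i) = 0) : eval₂ s x P = 0 := by
  obtain ⟨N, hN⟩ := h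
  have : Ideal.span (Set.range Q) ≤ RingHom.ker (eval₂Hom s x) := by
    rw [Ideal.span_le]
    rintro _ ⟨i, rfl⟩
    exact hx i
  have := this hN
  rw [RingHom.mem_ker, map_pow] at this
  exact eq_zero_of_pow_eq_zero this

end Specialization
section GenericMatrices

open MvPolynomial

variable {R S : Type*} [CommRing R] [CommRing S] {m : ℕ}

/-- The polynomial in two generic matrices `A`, `B` given by `f (A * B) * det A * det B`. -/
def productPoly (f : MvPolynomial (Fin m × Fin m) R) :
    MvPolynomial ((Fin m × Fin m) ⊕ (Fin m × Fin m)) R :=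
  bind₁ (fun q => ∑ j, X (Sum.inl (q.1, j)) * X (Sum.inr (j, q.2))) f *
    (Matrix.of fun i j => (X (Sum.inl (i, j)) : MvPolynomial _ R)).det *
    (Matrix.of fun i j => (X (Sum.inr (i, j)) : MvPolynomial _ R)).det

lemma map_productPoly (s : R →+* S) (f : MvPolynomial (Fin m × Fin m) R) :
    map s (productPoly f) = productPoly (map s f) := by
  simp only [productPoly, map_mul, map_bind₁, RingHom.map_det]
  congr <;> (try ext) <;> simp

lemma eval₂_productPoly (s : R →+* S) (f : MvPolynomial (Fin m × Fin m) R)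
    (A B : Matrix (Fin m) (Fin m) S) :
    eval₂ s (Sum.elim (fun q => A q.1 q.2) (fun q => B q.1 q.2)) (productPoly f) =
      eval₂ s (fun q => (A * B) q.1 q.2) f * A.det * B.det := by
  rw [← coe_eval₂Hom]
  simp only [productPoly, map_mul, RingHom.map_det, eval₂Hom_bind₁]
  congr <;> (try ext) <;> simp [Matrix.mul_apply]

/-- The entries of `(A - 1) ^ m` for a generic matrix `A` of size `m`. -/
def unipotentPoly (R : Type*) [CommRing R] (m : ℕ) (q : Fin m × Fin m) :
    MvPolynomial (Fin m × Fin m) R :=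
  (((Matrix.of fun i j => X (i, j)) - 1 : Matrix (Fin m) (Fin m) (MvPolynomial _ R)) ^ m) q.1 q.2

lemma map_unipotentPoly (s : R →+* S) (q : Fin m × Fin m) :
    map s (unipotentPoly R m q) = unipotentPoly S m q := by
  change RingHom.mapMatrix (map s) (_ ^ m) q.1 q.2 = _
  have h : RingHom.mapMatrix (map s) (Matrix.of fun i j : Fin m => (X (i, j) : MvPolynomial _ R)) =
      Matrix.of fun i j => X (i, j) := by
    ext1 i j
    simp
  rw [map_pow, map_sub, map_one, h, unipotentPoly]

lemma eval₂_unipotentPoly (s : R →+* S) (A : Matrix (Fin m) (Fin m) S) (q : Fin m × Fin m) :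
    eval₂ s (fun q => A q.1 q.2) (unipotentPoly R m q) = ((A - 1) ^ m) q.1 q.2 := by
  change RingHom.mapMatrix (eval₂Hom s fun q : Fin m × Fin m => A q.1 q.2) (_ ^ m) q.1 q.2 = _
  have h : RingHom.mapMatrix (eval₂Hom s fun q : Fin m × Fin m => A q.1 q.2)
      (Matrix.of fun i j : Fin m => X (i, j)) = A := by
    ext1 i j
    simp
  rw [map_pow, map_sub, map_one, h]

lemma mem_radical_of_forall_eval_eq_zero {k : Type*} [Field k] [IsAlgClosed k]
    {σ ι : Type*} [Finite σ] {P : MvPolynomial σ k} {Q : ι → MvPolynomial σ k}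
    (h : ∀ x : σ → k, (∀ i, eval x (Q i) = 0) → eval x P = 0) :
    P ∈ (Ideal.span (Set.range Q)).radical := by
  rw [← vanishingIdeal_zeroLocus_eq_radical (K := k), mem_vanishingIdeal_iff]
  intro x hx
  rw [mem_zeroLocus_iff] at hx
  simp only [aeval_eq_eval] at hx ⊢
  exact h x fun i => hx _ (Ideal.subset_span ⟨i, rfl⟩)

lemma IsZariskiClosedGL.exists_finset {k : Type u} [Field k] {m : ℕ}
    {Z : Set (Matrix.GeneralLinearGroup (Fin m) k)} (hZ : IsZariskiClosedGL Z) :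
    ∃ t : Finset (MvPolynomial (Fin m × Fin m) k), ∀ g : Matrix.GeneralLinearGroup (Fin m) k,
      g ∈ Z ↔ ∀ f ∈ t, eval (fun q => g.val q.1 q.2) f = 0 := by
  obtain ⟨S, rfl⟩ := hZ
  obtain ⟨t, ht⟩ := (isNoetherianRing_iff_ideal_fg _).1
    (inferInstance : IsNoetherianRing (MvPolynomial (Fin m × Fin m) k)) (Ideal.span S)
  refine ⟨t, fun g => ?_⟩
  have key : ∀ U : Set (MvPolynomial (Fin m × Fin m) k),
      (∀ f ∈ U, eval (fun q => g.val q.1 q.2) f = 0) ↔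
        Ideal.span U ≤ RingHom.ker (eval fun q => g.val q.1 q.2) := by
    intro U
    rw [Ideal.span_le]
    rfl
  have h1 := key S
  have h2 := key t
  rw [← ht] at h1
  exact h1.trans h2.symm

end GenericMatrices
section LinearReductivity

open MvPolynomial

/-- The spanning set of the functionals that vanish on all vectors fixed by `G`. -/
lemma mem_span_of_forall_fixed {k : Type*} [Field k] {Γ W : Type*} [Fintype W] [DecidableEq W]
    (T : Γ → Matrix W W k) (φ : W → k)
    (h : ∀ x : W → k, (∀ g, (T g).mulVec x = x) → φ ⬝ᵥ x = 0) :
    ∃ (N : ℕ) (g : Fin N → Γ) (ψ : Fin N → W → k),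
      φ = ∑ i, (Matrix.vecMul (ψ i) (T (g i)) - ψ i) := by
  let S : Set (W → k) := {χ | ∃ g ψ, χ = Matrix.vecMul ψ (T g) - ψ}
  have hφ : φ ∈ Submodule.span k S := by
    by_contra hn
    obtain ⟨f, hf, hker⟩ := Submodule.exists_le_ker_of_notMem hn
    let x : W → k := fun w => f fun j => if w = j then 1 else 0
    have hx : ∀ χ, f χ = χ ⬝ᵥ x := fun χ => by
      rw [LinearMap.pi_apply_eq_sum_univ f χ]
      rfl
    apply hf
    rw [hx]
    refine h x fun g => ?_
    refine dotProduct_eq _ _ fun ψ => ?_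
    rw [dotProduct_comm _ ψ, dotProduct_comm _ ψ]
    have h1 : f (Matrix.vecMul ψ (T g) - ψ) = 0 := hker (Submodule.subset_span ⟨g, ψ, rfl⟩)
    rw [hx, sub_dotProduct, sub_eq_zero, ← Matrix.dotProduct_mulVec] at h1
    exact h1
  obtain ⟨N, c, χ, hχ⟩ := Submodule.mem_span_set'.1 hφ
  choose g ψ hgψ using fun i => (χ i).2
  refine ⟨N, g, fun i => c i • ψ i, ?_⟩
  rw [← hχ]
  refine Finset.sum_congr rfl fun i _ => ?_
  rw [hgψ, smul_sub, Matrix.smul_vecMul]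

lemma exists_map_subtype_eq {k : Type*} [Field k] {m : ℕ} {R : Subring k}
    {g : Matrix.GeneralLinearGroup (Fin m) k} (hg : ∀ i j, g.val i j ∈ R)
    (hg' : ∀ i j, g⁻¹.val i j ∈ R) :
    ∃ g' : Matrix.GeneralLinearGroup (Fin m) R,
      Matrix.GeneralLinearGroup.map R.subtype g' = g := by
  let A : Matrix (Fin m) (Fin m) R := Matrix.of fun i j => ⟨g.val i j, hg i j⟩
  let B : Matrix (Fin m) (Fin m) R := Matrix.of fun i j => ⟨g⁻¹.val i j, hg' i j⟩
  have hinj : Function.Injective (R.subtype.mapMatrix : Matrix (Fin m) (Fin m) R →+* _) :=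
    Matrix.map_injective Subtype.val_injective
  have hAB : A * B = 1 := hinj (by
    rw [map_mul, map_one]
    exact g.mul_inv)
  have hBA : B * A = 1 := hinj (by
    rw [map_mul, map_one]
    exact g.inv_mul)
  exact ⟨⟨A, B, hAB, hBA⟩, Units.ext rfl⟩

lemma vecMul_tensorPowMatrix_map {R S : Type*} [CommRing R] [CommRing S] {ι α : Type*}
    [Fintype ι] [DecidableEq ι] [Fintype α] [DecidableEq α] (s : R →+* S) (φ : (α → ι) → R)
    (A : Matrix ι ι R) :
    Matrix.vecMul (s ∘ φ) (tensorPowMatrix α (A.map s)) =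
      s ∘ Matrix.vecMul φ (tensorPowMatrix α A) := by
  ext w
  rw [tensorPowMatrix_map, Function.comp_apply, RingHom.map_vecMul]

/-- A Zariski-closed group without nontrivial unipotents is linearly reductive on tensor powers:
nonzero invariant functionals are nonzero on invariant vectors. -/
theorem exists_fixed_dotProduct_ne_zero {k : Type u} [Field k] [IsAlgClosed k] (p : ℕ)
    [Fact p.Prime] [CharP k p] {m : ℕ} (G : Subgroup (Matrix.GeneralLinearGroup (Fin m) k))
    (hclosed : IsZariskiClosedGL (G : Set (Matrix.GeneralLinearGroup (Fin m) k)))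
    (huni : ∀ g ∈ G, IsUnipotentGL g → g = 1)
    {α : Type*} [Fintype α] [DecidableEq α] (φ : (α → Fin m) → k) (hφ : φ ≠ 0)
    (hinv : ∀ g ∈ G, Matrix.vecMul φ (tensorPowMatrix α g.val) = φ) :
    ∃ x : (α → Fin m) → k, (∀ g ∈ G, Matrix.mulVec (tensorPowMatrix α g.val) x = x) ∧
      φ ⬝ᵥ x ≠ 0 := by
  by_contra! hcon
  obtain ⟨N, g, ψ, hψ⟩ := mem_span_of_forall_fixed
    (fun g : G => tensorPowMatrix α g.1.val) φ (fun x hx => hcon x fun g hg => hx ⟨g, hg⟩)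
  obtain ⟨w₀, hw₀⟩ := Function.ne_iff.1 hφ
  obtain ⟨t, ht⟩ := hclosed.exists_finset
  have hdet : ∀ {A : Matrix (Fin m) (Fin m) k}, A.det ≠ 0 →
      (∀ f ∈ t, eval (fun q => A q.1 q.2) f = 0) → ∃ g ∈ G, g.val = A := fun {A} hA hf =>
    ⟨Matrix.GeneralLinearGroup.mkOfDetNeZero A hA, (ht _).2 hf, rfl⟩
  have hprod : ∀ f : t, productPoly f.1 ∈ (Ideal.span (Set.range
      (Sum.elim (fun f : t => rename Sum.inl f.1) (fun f : t => rename Sum.inr f.1)))).radical := by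
    intro f
    refine mem_radical_of_forall_eval_eq_zero fun x hx => ?_
    let A : Matrix (Fin m) (Fin m) k := fun i j => x (Sum.inl (i, j))
    let B : Matrix (Fin m) (Fin m) k := fun i j => x (Sum.inr (i, j))
    have hxAB : x = Sum.elim (fun q => A q.1 q.2) (fun q => B q.1 q.2) := by
      ext (q | q) <;> rfl
    rw [hxAB, ← eval₂_id, eval₂_productPoly]
    by_cases hA : A.det = 0
    · simp [hA]
    by_cases hB : B.det = 0
    · simp [hB]
    obtain ⟨a, ha, haA⟩ := hdet hA fun f hf => by
      have := hx (Sum.inl ⟨f, hf⟩)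
      rwa [Sum.elim_inl, eval_rename] at this
    obtain ⟨b, hb, hbB⟩ := hdet hB fun f hf => by
      have := hx (Sum.inr ⟨f, hf⟩)
      rwa [Sum.elim_inr, eval_rename] at this
    have := (ht _).1 (G.mul_mem ha hb) f.1 f.2
    rw [Units.val_mul, haA, hbB, ← eval₂_id] at this
    simp [this]
  have hunip : ∀ q : Fin m × Fin m, X q - C (if q.1 = q.2 then 1 else 0) ∈ (Ideal.span (Set.range
      (Sum.elim (fun f : t => f.1) (unipotentPoly k m)))).radical := by
    intro q
    refine mem_radical_of_forall_eval_eq_zero fun x hx => ?_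
    let A : Matrix (Fin m) (Fin m) k := fun i j => x (i, j)
    have hA : (A - 1) ^ m = 0 := by
      ext i j
      have := hx (Sum.inr (i, j))
      rw [Sum.elim_inr, ← eval₂_id] at this
      exact (eval₂_unipotentPoly (RingHom.id k) A (i, j)).symm.trans this
    have hAdet : A.det ≠ 0 := by
      have h1 : IsUnit A := by
        have := (IsNilpotent.isUnit_add_one (r := A - 1) ⟨m, hA⟩)
        rwa [sub_add_cancel] at this
      exact ((Matrix.isUnit_iff_isUnit_det A).1 h1).ne_zero
    obtain ⟨a, ha, haA⟩ := hdet hAdet fun f hf => hx (Sum.inl ⟨f, hf⟩)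
    have h1 : A = 1 := by
      rw [← haA, huni a ha (by rw [IsUnipotentGL, haA, hA]), Units.val_one]
    have h2 : x q = (1 : Matrix (Fin m) (Fin m) k) q.1 q.2 := by rw [← h1]
    simp [h2, Matrix.one_apply]
  choose Cp hCp hCp' using fun f => exists_finite_coeffs_of_mem_radical (hprod f)
  choose Cu hCu hCu' using fun q => exists_finite_coeffs_of_mem_radical (hunip q)
  obtain ⟨R, hR, F, _, _, _, ⟨s⟩⟩ := exists_specialization p (k := k)
    (C := (⋃ f, Cp f) ∪ (⋃ q, Cu q) ∪ (⋃ f : t, (f.1.coeffs : Set k)) ∪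
      (⋃ i, ⋃ a, ⋃ b, {(g i).1.val a b}) ∪ (⋃ i, ⋃ a, ⋃ b, {((g i).1⁻¹).val a b}) ∪
      (⋃ i, Set.range (ψ i)) ∪ Set.range φ ∪ {(φ w₀)⁻¹}) (by
      simp only [Set.finite_union]
      refine ⟨⟨⟨⟨⟨⟨⟨?_, ?_⟩, ?_⟩, ?_⟩, ?_⟩, ?_⟩, ?_⟩, ?_⟩
      · exact Set.finite_iUnion hCp
      · exact Set.finite_iUnion hCu
      · exact Set.finite_iUnion fun f => Finset.finite_toSet _
      · exact Set.finite_iUnion fun i => Set.finite_iUnion fun a => Set.finite_iUnion fun b =>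
          Set.finite_singleton _
      · exact Set.finite_iUnion fun i => Set.finite_iUnion fun a => Set.finite_iUnion fun b =>
          Set.finite_singleton _
      · exact Set.finite_iUnion fun i => Set.finite_range _
      · exact Set.finite_range _
      · exact Set.finite_singleton _)
  simp only [Set.union_subset_iff, Set.iUnion_subset_iff, Set.singleton_subset_iff,
    Set.range_subset_iff] at hR
  obtain ⟨⟨⟨⟨⟨⟨⟨hRp, hRu⟩, hRt⟩, hRg⟩, hRg'⟩, hRψ⟩, hRφ⟩, hRw⟩ := hR
  have hlift : ∀ f : t, ∃ f' : MvPolynomial (Fin m × Fin m) R, map R.subtype f' = f.1 := by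
    intro f
    have : f.1 ∈ Set.range (map (σ := Fin m × Fin m) R.subtype) := by
      rw [mem_range_map_iff_coeffs_subset]
      exact fun c hc => ⟨⟨c, hRt f hc⟩, rfl⟩
    exact this
  choose f' hf' using hlift
  let φ' : (α → Fin m) → R := fun w => ⟨φ w, hRφ w⟩
  let ψ' : Fin N → (α → Fin m) → R := fun i w => ⟨ψ i w, hRψ i w⟩
  have hmem : ∀ (a : Matrix.GeneralLinearGroup (Fin m) k) (A : Matrix (Fin m) (Fin m) R),
      a.val = A.map R.subtype → a ∈ G → ∀ f : t,
      eval₂ s (fun q => A.map s q.1 q.2) (f' f) = 0 := by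
    intro a A haA ha f
    have h1 := (ht a).1 ha f.1 f.2
    rw [haA, ← hf', MvPolynomial.eval_map] at h1
    have h2 : MvPolynomial.eval (fun q => A q.1 q.2) (f' f) = 0 := by
      apply Subtype.val_injective
      rw [ZeroMemClass.coe_zero, ← h1]
      exact hom_eval₂ _ (RingHom.id R) R.subtype _
    have h3 := hom_eval₂ (f' f) (RingHom.id R) s fun q => A q.1 q.2
    rw [eval₂_id, h2, map_zero] at h3
    exact h3.symm
  choose g' hg' using fun i => exists_map_subtype_eq (hRg i) (hRg' i)
  let H : Submonoid (Matrix.GeneralLinearGroup (Fin m) F) :=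
    { carrier := {h | ∀ f, eval₂ s (fun q => h.val q.1 q.2) (f' f) = 0}
      one_mem' := fun f => by
        have := hmem 1 1 (by simp) G.one_mem f
        rwa [Matrix.map_one s (map_zero s) (map_one s)] at this
      mul_mem' := fun {a b} ha hb f => by
        have h1 := eval₂_eq_zero_of_mem_radical (hCp' f R (hRp f) (productPoly (f' f))
          (Sum.elim (fun f => rename Sum.inl (f' f)) (fun f => rename Sum.inr (f' f)))
          (by rw [map_productPoly, hf']) (by rintro (i | i) <;> simp [map_rename, hf'])) s
          (Sum.elim (fun q => a.val q.1 q.2) (fun q => b.val q.1 q.2))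
          (by
            rintro (i | i)
            · simpa [eval₂_rename] using ha i
            · simpa [eval₂_rename] using hb i)
        rw [eval₂_productPoly] at h1
        have hadet := ((Matrix.isUnit_iff_isUnit_det a.val).1 a.isUnit).ne_zero
        have hbdet := ((Matrix.isUnit_iff_isUnit_det b.val).1 b.isUnit).ne_zero
        simpa [hadet, hbdet] using h1 }
  have hHuni : ∀ h ∈ H, IsUnipotentGL h → h = 1 := by
    intro h hh hu
    ext i j
    have h1 := eval₂_eq_zero_of_mem_radical (hCu' (i, j) R (hRu _)
      (X (i, j) - C (if i = j then 1 else 0))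
      (Sum.elim f' (unipotentPoly R m))
      (by simp only [map_sub, map_X, map_C]; split_ifs <;> simp)
      (by rintro (i | i) <;> simp [map_unipotentPoly, hf'])) s (fun q => h.val q.1 q.2)
      (by
        rintro (i | i)
        · exact hh i
        · rw [IsUnipotentGL] at hu
          simp [eval₂_unipotentPoly, hu])
    rw [eval₂_sub, eval₂_X, eval₂_C, sub_eq_zero] at h1
    rw [h1, Units.val_one, Matrix.one_apply]
    split_ifs <;> simp
  let gF : Fin N → Matrix.GeneralLinearGroup (Fin m) F := fun i =>
    Matrix.GeneralLinearGroup.map s (g' i)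
  have hHle : ∀ h ∈ Subgroup.closure (Set.range gF), h ∈ H := by
    intro h hh
    induction hh using Subgroup.closure_induction with
    | mem h hh =>
      obtain ⟨i, rfl⟩ := hh
      exact hmem (g i).1 (g' i).val (by rw [← hg']; rfl) (g i).2
    | one => exact H.one_mem
    | mul a b _ _ ha hb => exact H.mul_mem ha hb
    | inv a _ ha =>
      have : a⁻¹ = a ^ (orderOf a - 1) := by
        rw [inv_eq_iff_mul_eq_one, ← pow_succ', Nat.sub_add_cancel (orderOf_pos a),
          pow_orderOf_eq_one]
      rw [this]
      exact H.pow_mem ha _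
  have hval : ∀ i, (g i).1.val = (g' i).val.map R.subtype := fun i => by rw [← hg']; rfl
  have hφinv : ∀ i, Matrix.vecMul φ' (tensorPowMatrix α (g' i).val) = φ' := by
    intro i
    have := hinv _ (g i).2
    rw [hval] at this
    exact Subtype.val_injective.comp_left
      ((vecMul_tensorPowMatrix_map R.subtype φ' (g' i).val).symm.trans this)
  have hφψ : φ' = ∑ i, (Matrix.vecMul (ψ' i) (tensorPowMatrix α (g' i).val) - ψ' i) := by
    ext w
    have := congrFun hψ w
    simp only [Finset.sum_apply, Pi.sub_apply, AddSubmonoidClass.coe_finsetSum,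
      AddSubgroupClass.coe_sub] at this ⊢
    refine this.trans ?_
    refine Finset.sum_congr rfl fun i _ => ?_
    rw [hval]
    exact congrArg (· - _) (congrFun (vecMul_tensorPowMatrix_map R.subtype (ψ' i) _) w)
  obtain ⟨x, hx, hφx⟩ := exists_fixed_of_finite (Subgroup.closure (Set.range gF))
    (card_ne_zero_of_no_unipotent p _ fun h hh => hHuni h (hHle h hh)) (tensorPowMatrix α)
    (s ∘ φ') (fun h0 => by
      have h1 : φ' w₀ * ⟨(φ w₀)⁻¹, hRw⟩ = 1 := Subtype.ext (mul_inv_cancel₀ hw₀)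
      have h2 := congrArg s h1
      rw [map_mul, map_one, show s (φ' w₀) = 0 from congrFun h0 w₀, zero_mul] at h2
      exact zero_ne_one h2) (by
      intro h hh
      induction hh using Subgroup.closure_induction with
      | mem h hh =>
        obtain ⟨i, rfl⟩ := hh
        exact (vecMul_tensorPowMatrix_map s φ' (g' i).val).trans (by rw [hφinv])
      | one => simp
      | mul a b _ _ ha hb =>
        rw [Units.val_mul, map_mul, ← Matrix.vecMul_vecMul, ha, hb]
      | inv a _ ha =>
        conv_lhs => rw [← ha]
        rw [Matrix.vecMul_vecMul, ← map_mul, Units.mul_inv, map_one, Matrix.vecMul_one])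
  apply hφx
  have hsφ : s ∘ φ' =
      ∑ i, (Matrix.vecMul (s ∘ ψ' i) (tensorPowMatrix α (gF i).val) - s ∘ ψ' i) := by
    have : ∀ i, Matrix.vecMul (s ∘ ψ' i) (tensorPowMatrix α (gF i).val) =
        s ∘ Matrix.vecMul (ψ' i) (tensorPowMatrix α (g' i).val) := fun i =>
      vecMul_tensorPowMatrix_map s (ψ' i) (g' i).val
    simp only [this]
    ext w
    simpa using congrArg s (congrFun hφψ w)
  rw [hsφ, sum_dotProduct]
  refine Finset.sum_eq_zero fun i _ => ?_
  rw [sub_dotProduct, ← Matrix.dotProduct_mulVec, hx _ (Subgroup.subset_closure ⟨i, rfl⟩),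
    sub_self]

end LinearReductivity

section TrivialSummands

lemma le_finrank_of_mem_TS {k G : Type u} [Field k] [Monoid G] {E : Rep k G}
    [FiniteDimensional k E.V] {n : ℕ}
    (hn : ∃ W : Rep k G, Nonempty (E ≅ Rep.trivial k G (Fin n → k) ⊞ W)) :
    n ≤ Module.finrank k E.V := by
  obtain ⟨W, ⟨e⟩⟩ := hn
  have h : (biprod.inl ≫ e.inv) ≫ (e.hom ≫ biprod.fst) = 𝟙 (Rep.trivial k G (Fin n → k)) := by
    simp
  generalize e.hom ≫ biprod.fst = r at h
  have hinj : Function.Injective (biprod.inl ≫ e.inv).hom := fun x y hxy => by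
    rw [← Rep.id_apply (A := Rep.trivial k G (Fin n → k)) x,
      ← Rep.id_apply (A := Rep.trivial k G (Fin n → k)) y, ← h, Rep.comp_apply, Rep.comp_apply]
    exact congrArg _ hxy
  have := LinearMap.finrank_le_finrank_of_injective
    (f := (biprod.inl ≫ e.inv : Rep.trivial k G (Fin n → k) ⟶ E).hom.toLinearMap) hinj
  rwa [Module.finrank_fin_fun] at this

lemma TS_le_finrank {k G : Type u} [Field k] [Monoid G] (E : Rep k G)
    [FiniteDimensional k E.V] : TS E ≤ Module.finrank k E.V :=
  csSup_le' fun _ => le_finrank_of_mem_TS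

lemma le_TS_of_retract {k G : Type u} [Field k] [Monoid G] {E : Rep k G}
    [FiniteDimensional k E.V] {d : ℕ} (i : Rep.trivial k G (Fin d → k) ⟶ E)
    (r : E ⟶ Rep.trivial k G (Fin d → k)) (hir : i ≫ r = 𝟙 _) : d ≤ TS E := by
  have : IsSplitMono i := IsSplitMono.mk' ⟨r, hir⟩
  exact le_csSup ⟨Module.finrank k E.V, fun _ => le_finrank_of_mem_TS⟩ ⟨cokernel i,
    ⟨biprod.uniqueUpToIso _ _
      (isBilimitBinaryBiconeOfIsSplitMonoOfCokernel (cokernelIsCokernel i))⟩⟩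

/-- Invariant vectors paired perfectly with invariant functionals split off trivial summands. -/
lemma le_TS_of_pairing {k G : Type u} [Field k] [Monoid G] {E : Rep k G}
    [FiniteDimensional k E.V] {d : ℕ} (x : Fin d → E.V) (f : Fin d → Module.Dual k E.V)
    (hx : ∀ g j, E.ρ g (x j) = x j) (hf : ∀ g i v, f i (E.ρ g v) = f i v)
    (hfx : ∀ i j, f i (x j) = if i = j then 1 else 0) : d ≤ TS E := by
  let i : Rep.trivial k G (Fin d → k) ⟶ E :=
    Rep.ofHom (ρ := Representation.trivial k G (Fin d → k)) (σ := E.ρ)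
      ((Fintype.linearCombination k x).intertwiningMap_of_isIntertwiningMap _ _ fun g v => by
        simp [Fintype.linearCombination_apply, hx])
  let r : E ⟶ Rep.trivial k G (Fin d → k) :=
    Rep.ofHom (ρ := E.ρ) (σ := Representation.trivial k G (Fin d → k))
      ((LinearMap.pi f).intertwiningMap_of_isIntertwiningMap _ _ fun g v => by
        ext j
        simp [hf])
  refine le_TS_of_retract i r ?_
  refine Rep.hom_injective ?_
  ext v j
  change f j (Fintype.linearCombination k x _) = _
  rw [Fintype.linearCombination_apply, map_sum]
  simp [hfx]

end TrivialSummands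

section TensorPowerBasis

/-- The basis of `M ⊗ k^m` indexed by words, obtained from one on `M` by appending a letter. -/
def Module.Basis.tensorSnoc {k M : Type*} [Field k] [AddCommGroup M] [Module k M] {n m : ℕ}
    (b : Module.Basis (Fin n → Fin m) k M) :
    Module.Basis (Fin (n + 1) → Fin m) k (TensorProduct k M (Fin m → k)) :=
  (b.tensorProduct (Pi.basisFun k (Fin m))).reindex
    ((Equiv.prodComm _ _).trans (Fin.snocEquiv fun _ => Fin m))

lemma toMatrix_tensorSnoc_map {k M : Type*} [Field k] [AddCommGroup M] [Module k M] {n m : ℕ}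
    (b : Module.Basis (Fin n → Fin m) k M) (f : M →ₗ[k] M) (A : Matrix (Fin m) (Fin m) k)
    (w w' : Fin (n + 1) → Fin m) :
    LinearMap.toMatrix b.tensorSnoc b.tensorSnoc
        (TensorProduct.map f (Matrix.toLin' A)) w w' =
      LinearMap.toMatrix b b f (Fin.init w) (Fin.init w') * A (w (Fin.last n)) (w' (Fin.last n)) := by
  have h := congrFun (congrFun (TensorProduct.toMatrix_map b (Pi.basisFun k (Fin m)) b
    (Pi.basisFun k (Fin m)) f (Matrix.toLin' A))
    (Fin.init w, w (Fin.last n))) (Fin.init w', w' (Fin.last n))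
  rw [LinearMap.toMatrix_apply, Module.Basis.tensorSnoc, Module.Basis.repr_reindex_apply,
    Module.Basis.reindex_apply]
  rw [LinearMap.toMatrix_apply, Matrix.kroneckerMap_apply, ← Matrix.toLin_eq_toLin',
    LinearMap.toMatrix_toLin] at h
  rwa [← Matrix.toLin_eq_toLin']

lemma exists_basis_tpow {k G : Type u} [Field k] [Monoid G] {m : ℕ}
    (ρ : G →* Matrix.GeneralLinearGroup (Fin m) k) (n : ℕ) :
    ∃ b : Module.Basis (Fin n → Fin m) k (tpow (Rep.of (matRep ρ)) n).V, ∀ g,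
      LinearMap.toMatrix b b ((tpow (Rep.of (matRep ρ)) n).ρ g) =
        tensorPowMatrix (Fin n) (ρ g).val := by
  induction n with
  | zero =>
    refine ⟨Module.Basis.singleton (Fin 0 → Fin m) k, fun g => ?_⟩
    refine (LinearMap.toMatrix_id (Module.Basis.singleton (Fin 0 → Fin m) k)).trans ?_
    ext w w'
    simp [tensorPowMatrix_apply, Matrix.one_apply, Subsingleton.elim w w']
  | succ n ih =>
    obtain ⟨b, hb⟩ := ih
    refine ⟨b.tensorSnoc, fun g => ?_⟩
    ext w w'
    refine (toMatrix_tensorSnoc_map b _ (ρ g).val w w').trans ?_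
    rw [hb, tensorPowMatrix_apply, tensorPowMatrix_apply, Fin.prod_univ_castSucc]
    rfl

/-- Invariant functionals in word coordinates bound the number of trivial summands from below, as
soon as nonzero invariant functionals are nonzero on invariant vectors. -/
lemma le_TS_of_linearIndependent {k G : Type u} [Field k] [Monoid G] {E : Rep k G}
    {ι : Type*} [Fintype ι] [DecidableEq ι] (b : Module.Basis ι k E.V) {d : ℕ}
    (φ : Fin d → ι → k) (hφ : LinearIndependent k φ)
    (hinv : ∀ g j, Matrix.vecMul (φ j) (LinearMap.toMatrix b b (E.ρ g)) = φ j)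
    (hpair : ∀ χ : ι → k, χ ≠ 0 →
      (∀ g, Matrix.vecMul χ (LinearMap.toMatrix b b (E.ρ g)) = χ) →
      ∃ x : ι → k, (∀ g, Matrix.mulVec (LinearMap.toMatrix b b (E.ρ g)) x = x) ∧ χ ⬝ᵥ x ≠ 0) :
    d ≤ TS E := by
  have := Module.Finite.of_basis b
  let X : Submodule k (ι → k) :=
    { carrier := {x | ∀ g, Matrix.mulVec (LinearMap.toMatrix b b (E.ρ g)) x = x}
      zero_mem' := fun g => Matrix.mulVec_zero _
      add_mem' := fun {x y} hx hy g => by rw [Matrix.mulVec_add, hx g, hy g]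
      smul_mem' := fun c x hx g => by rw [Matrix.mulVec_smul, hx g] }
  let P : X →ₗ[k] Fin d → k := (LinearMap.pi fun j => dotProductBilin k k (φ j)) ∘ₗ X.subtype
  have hP : ∀ x j, P x j = φ j ⬝ᵥ x.1 := fun x j => rfl
  have hsurj : LinearMap.range P = ⊤ := by
    by_contra hne
    obtain ⟨f, hf, hker⟩ := Submodule.exists_le_ker_of_lt_top _ (lt_top_iff_ne_top.2 hne)
    let c : Fin d → k := fun j => f (Pi.single j 1)
    have hfc : ∀ v, f v = ∑ j, c j * v j := fun v => by
      rw [LinearMap.pi_apply_eq_sum_univ f v]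
      refine Finset.sum_congr rfl fun j _ => ?_
      rw [smul_eq_mul, mul_comm]
      congr 2
      ext i
      simp [Pi.single_apply, eq_comm]
    have hc : ∑ j, c j • φ j ≠ 0 := fun h0 => by
      have hc0 := Fintype.linearIndependent_iff.1 hφ c h0
      apply hf
      ext v
      simp [hfc, hc0]
    obtain ⟨x, hx, hcx⟩ := hpair _ hc fun g => by
      simp only [Matrix.sum_vecMul, Matrix.smul_vecMul, hinv]
    apply hcx
    have : f (P ⟨x, hx⟩) = 0 := hker ⟨_, rfl⟩
    rw [hfc] at this
    simpa [sum_dotProduct, hP] using this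
  choose x hx using fun j : Fin d => LinearMap.range_eq_top.1 hsurj (Pi.single j 1)
  refine le_TS_of_pairing (fun j => b.equivFun.symm (x j).1)
    (fun j => dotProductBilin k k (φ j) ∘ₗ b.equivFun.toLinearMap) (fun g j => ?_)
    (fun g j v => ?_) fun i j => ?_
  · apply b.equivFun.injective
    have := LinearMap.toMatrix_mulVec_repr b b (E.ρ g) (b.equivFun.symm (x j).1)
    rw [LinearEquiv.apply_symm_apply]
    refine (this.symm.trans ?_)
    rw [← Module.Basis.equivFun_apply, LinearEquiv.apply_symm_apply]
    exact (x j).2 g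
  · change φ j ⬝ᵥ b.repr _ = φ j ⬝ᵥ b.repr v
    rw [← LinearMap.toMatrix_mulVec_repr b b, Matrix.dotProduct_mulVec, hinv]
  · change φ i ⬝ᵥ b.equivFun (b.equivFun.symm _) = _
    rw [LinearEquiv.apply_symm_apply, ← hP, hx, Pi.single_apply]

end TensorPowerBasis

section WordSign

variable {R : Type*} [CommRing R] {m : ℕ}

/-- The sign of a word `u` in `m` letters of length `m`, and zero if a letter is repeated. -/
def wordSign (R : Type*) [CommRing R] {m : ℕ} (u : Fin m → Fin m) : R :=
  ((1 : Matrix (Fin m) (Fin m) R).submatrix u id).det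

lemma wordSign_perm (σ : Equiv.Perm (Fin m)) :
    wordSign R σ = ((Equiv.Perm.sign σ : ℤ) : R) := by
  rw [wordSign, Matrix.det_permute, Matrix.det_one, mul_one]

lemma injective_of_wordSign_ne_zero {u : Fin m → Fin m} (hu : wordSign R u ≠ 0) :
    Function.Injective u := fun i j hij => by
  by_contra hne
  refine hu (Matrix.det_zero_of_row_eq hne ?_)
  ext a
  change (1 : Matrix (Fin m) (Fin m) R) (u i) a = (1 : Matrix (Fin m) (Fin m) R) (u j) a
  rw [hij]

lemma sum_wordSign_mul (A : Matrix (Fin m) (Fin m) R) (v : Fin m → Fin m) :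
    ∑ u, wordSign R u * ∏ i, A (u i) (v i) = A.det * wordSign R v := by
  have h : A.transpose.submatrix v id =
      Matrix.of fun i => ∑ j, A j (v i) • (1 : Matrix (Fin m) (Fin m) R) j := by
    ext i a
    simp [Finset.sum_apply, Matrix.one_apply]
  have h1 : A.transpose.submatrix v id =
      (1 : Matrix (Fin m) (Fin m) R).submatrix v id * A.transpose := by
    ext i a
    simp [Matrix.mul_apply, Matrix.one_apply]
  have h2 := congrArg Matrix.det h
  rw [h1, Matrix.det_mul, Matrix.det_transpose, mul_comm] at h2
  rw [wordSign, h2]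
  have h3 := (Matrix.detRowAlternating (R := R) (n := Fin m)).toMultilinearMap.map_sum
    (fun i j => A j (v i) • (1 : Matrix (Fin m) (Fin m) R) j)
  refine Eq.trans ?_ h3.symm
  refine Finset.sum_congr rfl fun u _ => ?_
  rw [MultilinearMap.map_smul_univ, smul_eq_mul, mul_comm]
  rfl

/-- The product of the signs of the words read off along the columns of a layout `e`. -/
def columnFunctional (R : Type*) [CommRing R] {m : ℕ} {C α : Type*} [Fintype C]
    (e : C × Fin m ≃ α) (w : α → Fin m) : R :=
  ∏ c, wordSign R fun i => w (e (c, i))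

/-- The word whose letters are the row indices of a layout. -/
def layoutWord {C α : Type*} (e : C × Fin m ≃ α) (a : α) : Fin m := (e.symm a).2

lemma columnFunctional_layoutWord {C α : Type*} [Fintype C] (e : C × Fin m ≃ α) :
    columnFunctional R e (layoutWord e) = 1 := by
  refine Finset.prod_eq_one fun c _ => ?_
  have : (fun i => layoutWord e (e (c, i))) = (1 : Equiv.Perm (Fin m)) := by
    ext i
    simp [layoutWord]
  rw [this, wordSign_perm]
  simp

variable {C α : Type*} [Fintype C] [DecidableEq C] [Fintype α] [DecidableEq α]

lemma columnFunctional_vecMul (e : C × Fin m ≃ α) (A : Matrix (Fin m) (Fin m) R) :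
    Matrix.vecMul (columnFunctional R e) (tensorPowMatrix α A) =
      A.det ^ Fintype.card C • columnFunctional R e := by
  ext w
  let E : (α → Fin m) ≃ (C → Fin m → Fin m) :=
    (Equiv.arrowCongr e.symm (Equiv.refl _)).trans (Equiv.curry _ _ _)
  calc Matrix.vecMul (columnFunctional R e) (tensorPowMatrix α A) w
      = ∑ u : α → Fin m, ∏ c, (wordSign R (E u c) * ∏ i, A (E u c i) (E w c i)) := by
        refine Finset.sum_congr rfl fun u _ => ?_
        change columnFunctional R e u * tensorPowMatrix α A u w = _
        rw [Finset.prod_mul_distrib, tensorPowMatrix_apply, ← e.prod_comp, Fintype.prod_prod_type]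
        rfl
    _ = ∑ U : C → Fin m → Fin m, ∏ c, (wordSign R (U c) * ∏ i, A (U c i) (E w c i)) :=
        E.sum_comp fun U => ∏ c, (wordSign R (U c) * ∏ i, A (U c i) (E w c i))
    _ = ∏ c, ∑ u : Fin m → Fin m, (wordSign R u * ∏ i, A (u i) (E w c i)) :=
        (Fintype.prod_sum fun c u => wordSign R u * ∏ i, A (u i) (E w c i)).symm
    _ = _ := by
        simp only [sum_wordSign_mul, Finset.prod_mul_distrib, Finset.prod_const, Finset.card_univ]
        rfl

end WordSign

section Independence

variable {m : ℕ}

lemma Fin.sum_mul_perm_le (a : ℕ) (σ : Equiv.Perm (Fin m)) :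
    ∑ i : Fin m, (a + (i : ℕ)) * (σ i : ℕ) ≤ ∑ i : Fin m, (a + (i : ℕ)) * (i : ℕ) := by
  refine Monovary.sum_mul_comp_perm_le_sum_mul (f := fun i : Fin m => a + (i : ℕ))
    (g := fun i : Fin m => (i : ℕ)) fun i j hij => ?_
  exact Nat.add_le_add_left hij.le a

lemma Fin.eq_one_of_sum_mul_perm_eq {a : ℕ} {σ : Equiv.Perm (Fin m)}
    (h : ∑ i : Fin m, (a + (i : ℕ)) * (σ i : ℕ) = ∑ i : Fin m, (a + (i : ℕ)) * (i : ℕ)) : σ = 1 := by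
  have h1 := (Monovary.sum_mul_comp_perm_eq_sum_mul_iff (σ := σ)
    (f := fun i : Fin m => a + (i : ℕ)) (g := fun i : Fin m => (i : ℕ))
    fun i j hij => Nat.add_le_add_left hij.le a).1 h
  have h2 : StrictMono σ := fun i j hij => by
    refine lt_of_le_of_ne (not_lt.1 fun hlt => ?_) (σ.injective.ne hij.ne)
    have := h1 hlt
    simp only [add_le_add_iff_left, Fin.val_fin_le] at this
    exact absurd hij (not_lt.2 this)
  exact Equiv.ext (congrFun h2.eq_id)

variable {C α : Type*} [Fintype C] [Fintype α]

/-- Among the words with nonzero column functional, the layout word maximizes the weight. -/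
lemma eq_layoutWord_of_columnFunctional_ne_zero {R : Type*} [CommRing R] (e : C × Fin m ≃ α)
    (wt : α → ℕ) (κ : C → ℕ) (hwt : ∀ c i, wt (e (c, i)) = κ c + i) {w : α → Fin m}
    (hw : columnFunctional R e w ≠ 0)
    (hle : ∑ c, ∑ i : Fin m, (κ c + (i : ℕ)) * (i : ℕ) ≤ ∑ a, wt a * (w a : ℕ)) :
    w = layoutWord e := by
  have hinj : ∀ c, Function.Bijective fun i => w (e (c, i)) := fun c =>
    Finite.injective_iff_bijective.1 (injective_of_wordSign_ne_zero (R := R) fun h =>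
      hw (Finset.prod_eq_zero (Finset.mem_univ c) h))
  let σ : C → Equiv.Perm (Fin m) := fun c => Equiv.ofBijective _ (hinj c)
  have hσ : ∀ c i, σ c i = w (e (c, i)) := fun c i => rfl
  rw [← e.sum_comp, Fintype.sum_prod_type] at hle
  simp only [hwt, ← hσ] at hle
  have heq := (Finset.sum_eq_sum_iff_of_le fun c _ => Fin.sum_mul_perm_le (κ c) (σ c)).1
    ((Finset.sum_le_sum fun c _ => Fin.sum_mul_perm_le (κ c) (σ c)).antisymm hle)
  ext a
  obtain ⟨⟨c, i⟩, rfl⟩ := e.surjective a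
  rw [← hσ, Fin.eq_one_of_sum_mul_perm_eq (heq c (Finset.mem_univ c))]
  simp [layoutWord]

lemma linearIndependent_columnFunctional (k : Type*) [Field k] {J : Type*} [Finite J]
    (e : J → (C × Fin m ≃ α)) (wt : α → ℕ) (κ : C → ℕ)
    (hwt : ∀ j c i, wt (e j (c, i)) = κ c + i)
    (hinj : Function.Injective fun j => layoutWord (e j)) :
    LinearIndependent k fun j => columnFunctional k (e j) := by
  have := Fintype.ofFinite J
  rw [Fintype.linearIndependent_iff]
  intro g hg j
  have h := congrFun hg (layoutWord (e j))
  rw [Finset.sum_apply, Finset.sum_eq_single j] at h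
  · simpa [columnFunctional_layoutWord] using h
  · intro i _ hij
    rw [Pi.smul_apply, smul_eq_mul, mul_eq_zero, or_iff_not_imp_right]
    intro hne
    refine absurd (hinj (eq_layoutWord_of_columnFunctional_ne_zero (e i) wt κ (hwt i) hne ?_).symm)
      hij
    rw [← (e j).sum_comp, Fintype.sum_prod_type]
    simp [hwt, layoutWord]
  · simp

end Independence

section Layouts

/-- The words obtained by permuting the word `(i, t) ↦ i`, with each of `m` letters repeated
`l` times. -/
def balancedWords (m l : ℕ) : Set (Fin m × Fin l → Fin m) :=
  Set.range fun (σ : Equiv.Perm (Fin m × Fin l)) q => (σ q).1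

open DomMulAct in
lemma card_balancedWords_mul (m l : ℕ) :
    Nat.card (balancedWords m l) * (l.factorial) ^ m = (m * l).factorial := by
  classical
  have h1 : balancedWords m l =
      MulAction.orbit (Equiv.Perm (Fin m × Fin l))ᵈᵐᵃ (Prod.fst : Fin m × Fin l → Fin m) := by
    ext f
    constructor
    · rintro ⟨σ, rfl⟩
      exact ⟨mk σ, rfl⟩
    · rintro ⟨c, rfl⟩
      exact ⟨mk.symm c, rfl⟩
  have h2 := (MulAction.stabilizer (Equiv.Perm (Fin m × Fin l))ᵈᵐᵃ
    (Prod.fst : Fin m × Fin l → Fin m)).card_mul_index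
  have h3 : Nat.card (MulAction.stabilizer (Equiv.Perm (Fin m × Fin l))ᵈᵐᵃ
      (Prod.fst : Fin m × Fin l → Fin m)) = l.factorial ^ m := by
    have h4 := stabilizer_card (Prod.fst : Fin m × Fin l → Fin m)
    have h5 : ∀ i : Fin m, Fintype.card {q : Fin m × Fin l // q.1 = i} = l := fun i => by
      refine (Fintype.card_congr (⟨fun q => q.1.2, fun t => ⟨(i, t), rfl⟩, ?_, fun t => rfl⟩ :
        {q : Fin m × Fin l // q.1 = i} ≃ Fin l)).trans (Fintype.card_fin l)
      rintro ⟨⟨_, t⟩, rfl⟩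
      rfl
    simp only [h5, Finset.prod_const, Finset.card_univ, Fintype.card_fin] at h4
    rw [← h4, ← Nat.card_eq_fintype_card]
    exact Nat.card_congr (DomMulAct.mk.symm.subtypeEquiv fun c => DomMulAct.mem_stabilizer_iff)
  rw [h3, MulAction.index_stabilizer, ← h1, ← Nat.card_coe_set_eq, mul_comm] at h2
  rw [h2, Nat.card_congr (DomMulAct.mk (M := Equiv.Perm (Fin m × Fin l))).symm, Nat.card_perm,
    Nat.card_prod, Nat.card_fin, Nat.card_fin]

lemma pow_mul_factorial_pow_le (m : ℕ) {l : ℕ} (hl : 1 ≤ l) :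
    m ^ (m * l) * l.factorial ^ m ≤ (m * l).factorial * (m * l) ^ m := by
  induction l, hl using Nat.le_induction with
  | base =>
    simpa using Nat.le_mul_of_pos_left (m ^ m) m.factorial_pos
  | succ l hl ih =>
    have h1 : (m * l).factorial * (m * l) ^ m ≤ (m * (l + 1)).factorial :=
      (Nat.mul_le_mul_left _ (Nat.pow_le_pow_left (Nat.le_succ _) m)).trans
        (Nat.factorial_mul_pow_le_factorial)
    calc m ^ (m * (l + 1)) * (l + 1).factorial ^ m
        = m ^ (m * l) * l.factorial ^ m * (m * (l + 1)) ^ m := by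
          rw [Nat.factorial_succ, mul_pow, mul_pow m, mul_add_one m l, pow_add]
          ring
      _ ≤ _ := Nat.mul_le_mul_right _ (ih.trans h1)

lemma pow_le_card_balancedWords_mul (m : ℕ) {l : ℕ} (hl : 1 ≤ l) :
    m ^ (m * l) ≤ Nat.card (balancedWords m l) * (m * l) ^ m := by
  have h := pow_mul_factorial_pow_le m hl
  rw [← card_balancedWords_mul, mul_right_comm] at h
  exact Nat.le_of_mul_le_mul_right h (pow_pos l.factorial_pos m)

/-- The embedding of the full antidiagonals `b + i = β + m'` in the grid of cells `((b, t), i)`. -/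
def diagonalCell {m' l B : ℕ} (x : Fin B × (Fin (m' + 1) × Fin l)) :
    (Fin (B + m') × Fin l) × Fin (m' + 1) :=
  ((⟨x.1 + m' - x.2.1, by omega⟩, x.2.2), x.2.1)

lemma diagonalCell_injective {m' l B : ℕ} :
    Function.Injective (diagonalCell : Fin B × (Fin (m' + 1) × Fin l) → _) := by
  rintro ⟨β, i, t⟩ ⟨β', i', t'⟩ h
  simp only [diagonalCell, Prod.mk.injEq, Fin.mk.injEq] at h
  obtain ⟨⟨h1, rfl⟩, rfl⟩ := h
  have : β = β' := by
    ext
    omega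
  rw [this]

lemma exists_layouts (m' l B : ℕ) :
    ∃ e : (Fin B → balancedWords (m' + 1) l) →
      ((Fin (B + m') × Fin l) × Fin (m' + 1) ≃ (Fin (B + m') × Fin l) × Fin (m' + 1)),
      (∀ j x, ((e j x).1.1 : ℕ) + (e j x).2 = x.1.1 + x.2) ∧
      Function.Injective fun j => layoutWord (e j) := by
  choose σ hσ using fun f : balancedWords (m' + 1) l => f.2
  let f := Equiv.ofInjective (diagonalCell (m' := m') (l := l) (B := B)) diagonalCell_injective
  let P : (Fin B → balancedWords (m' + 1) l) → Equiv.Perm (Fin B × (Fin (m' + 1) × Fin l)) :=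
    fun j => Equiv.prodShear (Equiv.refl _) fun β => σ (j β)
  have hP : ∀ j x, ((P j).extendDomain f) (diagonalCell x) = diagonalCell (P j x) := fun j x =>
    Equiv.Perm.extendDomain_apply_image (P j) f x
  refine ⟨fun j => ((P j).extendDomain f).symm, fun j x => ?_, fun j j' h => ?_⟩
  · obtain ⟨y, rfl⟩ := ((P j).extendDomain f).surjective x
    rw [Equiv.symm_apply_apply]
    by_cases hy : y ∈ Set.range (diagonalCell (m' := m') (l := l) (B := B))
    · obtain ⟨z, rfl⟩ := hy
      rw [hP]
      simp [diagonalCell, P]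
      omega
    · rw [Equiv.Perm.extendDomain_apply_not_subtype _ _ hy]
  · ext β q
    have h1 := congrFun h (diagonalCell (β, q))
    simp only [layoutWord, Equiv.symm_symm, hP] at h1
    rw [← hσ, ← hσ]
    exact congrArg Fin.val h1

/-- There are many linearly independent functionals scaled by a power of the determinant. -/
lemma exists_linearIndependent_vecMul_eq (k : Type*) [Field k] (m' l B n : ℕ)
    (hn : (B + m') * l * (m' + 1) = n) :
    ∃ φ : Fin (Nat.card (balancedWords (m' + 1) l) ^ B) → (Fin n → Fin (m' + 1)) → k,
      LinearIndependent k φ ∧ ∀ j (A : Matrix (Fin (m' + 1)) (Fin (m' + 1)) k),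
        Matrix.vecMul (φ j) (tensorPowMatrix (Fin n) A) = A.det ^ ((B + m') * l) • φ j := by
  obtain ⟨e, he, hinj⟩ := exists_layouts m' l B
  let ε : (Fin (B + m') × Fin l) × Fin (m' + 1) ≃ Fin n :=
    Fintype.equivFinOfCardEq (by simp [hn])
  have hJ : Nat.card (Fin B → balancedWords (m' + 1) l) =
      Nat.card (balancedWords (m' + 1) l) ^ B := by
    rw [Nat.card_fun, Nat.card_fin]
  let δ := (Finite.equivFinOfCardEq hJ).symm
  refine ⟨fun j => columnFunctional k ((e (δ j)).trans ε), ?_, fun j A => ?_⟩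
  · refine (linearIndependent_columnFunctional k (fun j => (e j).trans ε)
      (fun a => ((ε.symm a).1.1 : ℕ) + (ε.symm a).2) (fun c => c.1) (fun j c i => ?_)
      fun j j' h => hinj ?_).comp δ δ.injective
    · simp [he]
    · ext a
      simpa [layoutWord] using congrArg Fin.val (congrFun h (ε a))
  · rw [columnFunctional_vecMul]
    simp

end Layouts

section Asymptotics

open Filter Topology

lemma tendsto_log_growth (a b c : ℝ) :
    Tendsto (fun l : ℕ => ((l : ℝ) * a - (b + Real.log l)) / (l + c)) atTop (𝓝 a) := by
  have h1 : Tendsto (fun l : ℕ => Real.log l / (l : ℝ)) atTop (𝓝 0) :=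
    Real.isLittleO_log_id_atTop.tendsto_div_nhds_zero.comp tendsto_natCast_atTop_atTop
  have h2 : Tendsto (fun l : ℕ => (a - (b / l + Real.log l / l)) / (1 + c / (l : ℝ))) atTop
      (𝓝 ((a - (0 + 0)) / (1 + 0))) :=
    (((tendsto_const_div_atTop_nhds_zero_nat b).add h1).const_sub a).div
      ((tendsto_const_div_atTop_nhds_zero_nat c).const_add 1) (by norm_num)
  rw [add_zero, sub_zero, add_zero, div_one] at h2
  refine h2.congr' ?_
  filter_upwards [eventually_ge_atTop 1] with l hl
  have hl0 : (l : ℝ) ≠ 0 := by positivity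
  rw [← mul_div_mul_left (a - (b / l + Real.log l / l)) (1 + c / (l : ℝ)) hl0]
  congr 1 <;> field_simp

/-- The `n`-th root of the number of functionals, for words of length `n`, is almost `m`. -/
lemma exp_le_card_balancedWords_rpow (m' : ℕ) {l : ℕ} (hl : 1 ≤ l) :
    Real.exp (((l : ℝ) * Real.log (m' + 1 : ℕ) - (Real.log (m' + 1 : ℕ) + Real.log l)) / (l + m')) ≤
      ((Nat.card (balancedWords (m' + 1) l) ^ l : ℕ) : ℝ) ^
        ((((l + m') * l * (m' + 1) : ℕ) : ℝ)⁻¹) := by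
  have h : (((m' + 1 : ℕ) : ℝ) ^ ((m' + 1) * l)) ≤
      (Nat.card (balancedWords (m' + 1) l) : ℝ) * (((m' + 1 : ℕ) : ℝ) * l) ^ (m' + 1) := by
    exact_mod_cast pow_le_card_balancedWords_mul (m' + 1) hl
  set M : ℕ := Nat.card (balancedWords (m' + 1) l)
  have hm : (0 : ℝ) < (m' + 1 : ℕ) := by positivity
  have hl' : (0 : ℝ) < l := by positivity
  have hM : (0 : ℝ) < M := by
    refine pos_of_mul_pos_left ((pow_pos hm _).trans_le h) (by positivity)
  have hlog := Real.log_le_log (pow_pos hm _) h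
  rw [Real.log_mul hM.ne' (by positivity), Real.log_pow, Real.log_pow,
    Real.log_mul hm.ne' hl'.ne', Nat.cast_mul] at hlog
  rw [Nat.cast_pow, Real.rpow_def_of_pos (pow_pos hM l), Real.exp_le_exp, Real.log_pow,
    ← div_eq_mul_inv, div_le_div_iff₀ (by positivity) (by positivity)]
  set x := Real.log (m' + 1 : ℕ)
  set y := Real.log (l : ℝ)
  have h2 : ((m' + 1 : ℕ) : ℝ) * (l * x - (x + y)) ≤ Real.log M := by linarith
  have h3 := mul_le_mul_of_nonneg_left h2 (show (0 : ℝ) ≤ (l + m') * l by positivity)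
  push_cast at h3 ⊢
  linarith

end Asymptotics

lemma exists_pow_det_eq_one {k : Type*} [Field k] {m : ℕ}
    (G : Subgroup (Matrix.GeneralLinearGroup (Fin m) k))
    (hfin : ((fun g : Matrix.GeneralLinearGroup (Fin m) k => Matrix.det g.val) ''
        (G : Set (Matrix.GeneralLinearGroup (Fin m) k))).Finite) :
    ∃ r, 0 < r ∧ ∀ g ∈ G, g.val.det ^ r = 1 := by
  let D := G.map (Matrix.GeneralLinearGroup.det : Matrix.GeneralLinearGroup (Fin m) k →* kˣ)
  have hD : Finite D := by
    refine Set.Finite.of_finite_image (f := Units.val) (hfin.subset ?_) Units.val_injective.injOn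
    rintro _ ⟨_, ⟨g, hg, rfl⟩, rfl⟩
    exact ⟨g, hg, rfl⟩
  refine ⟨Nat.card D, Nat.card_pos, fun g hg => ?_⟩
  have h : (⟨_, Subgroup.mem_map_of_mem _ hg⟩ : D) ^ Nat.card D = 1 := pow_card_eq_one'
  exact congrArg (fun d : D => (d.1 : k)) h

/-- Dimension bound for the number of trivial summands of a tensor power. -/
lemma TS_tpow_le {k G : Type u} [Field k] [Monoid G] {m : ℕ}
    (ρ : G →* Matrix.GeneralLinearGroup (Fin m) k) (n : ℕ) :
    TS (tpow (Rep.of (matRep ρ)) n) ≤ m ^ n := by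
  obtain ⟨b, -⟩ := exists_basis_tpow ρ n
  have := Module.Finite.of_basis b
  refine (TS_le_finrank _).trans ?_
  simp [Module.finrank_eq_card_basis b]

lemma card_pow_le_TS_tpow {k : Type u} [Field k] [IsAlgClosed k] (p : ℕ) [Fact p.Prime]
    [CharP k p] {m' : ℕ} (G : Subgroup (Matrix.GeneralLinearGroup (Fin (m' + 1)) k))
    (hclosed : IsZariskiClosedGL (G : Set (Matrix.GeneralLinearGroup (Fin (m' + 1)) k)))
    (huni : ∀ g ∈ G, IsUnipotentGL g → g = 1) {l : ℕ}
    (hdet : ∀ g ∈ G, g.val.det ^ l = 1) :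
    Nat.card (balancedWords (m' + 1) l) ^ l ≤
      TS (tpow (Rep.of (matRep G.subtype)) ((l + m') * l * (m' + 1))) := by
  obtain ⟨b, hb⟩ := exists_basis_tpow G.subtype ((l + m') * l * (m' + 1))
  obtain ⟨φ, hφ, hinv⟩ := exists_linearIndependent_vecMul_eq k m' l l _ rfl
  refine le_TS_of_linearIndependent b φ hφ (fun g j => ?_) fun χ hχ hχinv => ?_
  · rw [hb, hinv, pow_mul', Subgroup.subtype_apply, hdet g.1 g.2, one_pow, one_smul]
  · obtain ⟨x, hx, hχx⟩ := exists_fixed_dotProduct_ne_zero p G hclosed huni χ hχ fun g hg => by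
      have := hχinv ⟨g, hg⟩
      rwa [hb] at this
    exact ⟨x, fun g => by rw [hb]; exact hx g.1 g.2, hχx⟩

/-- **Theorem.** In characteristic `p > 0`, if the only unipotent element of the
Zariski-closed subgroup `G ≤ GL_m(k)` is the identity and the determinant takes finitely
many values on `G`, then `d(G, V) = m`. -/
theorem dG_eq_dim_of_no_unipotent_and_det_finite {k : Type u} [Field k] [IsAlgClosed k]
    (p : ℕ) (hp : 0 < p) [CharP k p] {m : ℕ}
    (G : Subgroup (Matrix.GeneralLinearGroup (Fin m) k))
    (hclosed : IsZariskiClosedGL (G : Set (Matrix.GeneralLinearGroup (Fin m) k)))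
    (huni : ∀ g ∈ G, IsUnipotentGL g → g = 1)
    (hfin : ((fun g : Matrix.GeneralLinearGroup (Fin m) k => Matrix.det g.val) ''
        (G : Set (Matrix.GeneralLinearGroup (Fin m) k))).Finite) :
    dG (Rep.of (matRep G.subtype)) = (m : ℝ) := by
  have : Fact p.Prime := ⟨(CharP.char_is_prime_or_zero k p).resolve_right hp.ne'⟩
  let u : ℕ → ℝ := fun n => (TS (tpow (Rep.of (matRep G.subtype)) n) : ℝ) ^ ((n : ℝ)⁻¹)
  have hu0 : ∀ n, 0 ≤ u n := fun n => Real.rpow_nonneg (Nat.cast_nonneg _) _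
  have hum : ∀ᶠ n in Filter.atTop, u n ≤ m := by
    filter_upwards [Filter.eventually_ne_atTop 0] with n hn
    calc u n ≤ ((m : ℝ) ^ n) ^ ((n : ℝ)⁻¹) :=
          Real.rpow_le_rpow (Nat.cast_nonneg _) (by exact_mod_cast TS_tpow_le G.subtype n)
            (by positivity)
      _ = m := Real.pow_rpow_inv_natCast (Nat.cast_nonneg m) hn
  have hbdd : Filter.IsBoundedUnder (· ≤ ·) Filter.atTop u := ⟨m, hum⟩
  have hcobdd : Filter.IsCoboundedUnder (· ≤ ·) Filter.atTop u :=
    Filter.isCoboundedUnder_le_of_le _ hu0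
  refine le_antisymm (Filter.limsup_le_of_le hcobdd hum) ?_
  rcases m with _ | m'
  · rw [Nat.cast_zero]
    exact Filter.le_limsup_of_frequently_le (Filter.Frequently.of_forall hu0) hbdd
  obtain ⟨r, hr, hdet⟩ := exists_pow_det_eq_one G hfin
  have hlim := (Real.continuous_exp.tendsto _).comp
    (tendsto_log_growth (Real.log (m' + 1 : ℕ)) (Real.log (m' + 1 : ℕ)) m')
  rw [Real.exp_log (by positivity)] at hlim
  refine le_of_forall_lt fun c hc => ?_
  obtain ⟨c', hcc', hc'⟩ := exists_between hc
  refine hcc'.trans_le (Filter.le_limsup_of_frequently_le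
    (Filter.frequently_atTop.2 fun N => ?_) hbdd)
  obtain ⟨N', hN'⟩ := Filter.eventually_atTop.1 (hlim.eventually (lt_mem_nhds hc'))
  let l := r * (N + N' + 1)
  have hl : N + N' + 1 ≤ l := Nat.le_mul_of_pos_left _ hr
  refine ⟨(l + m') * l * (m' + 1), ?_, ?_⟩
  · calc N ≤ l := by omega
      _ ≤ (l + m') * l := Nat.le_mul_of_pos_left _ (by omega)
      _ ≤ _ := Nat.le_mul_of_pos_right _ (Nat.succ_pos m')
  · refine (hN' l (by omega)).le.trans
      ((exp_le_card_balancedWords_rpow m' (by omega)).trans ?_)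
    refine Real.rpow_le_rpow (Nat.cast_nonneg _) (Nat.cast_le.2 ?_) (by positivity)
    exact card_pow_le_TS_tpow p G hclosed huni fun g hg => by rw [pow_mul, hdet g hg, one_pow]
end
end
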